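/- arXiv:1409.5711 — 11 statements merged into one kernel-verified Lean document; each statement's English description precedes it below -/
import Mathlib

section
/- Let H and K be Hilbert spaces (over the real or complex field), let S be a (not necessarily densely defined, possibly unbounded) linear operator from H to K and T a linear operator from K to H. If (a) the range of S is all of K, (b) the range of T is dense in H, and (c) ⟨Sh, k⟩ = ⟨h, Tk⟩ for all h in the domain of S and k in the domain of T, then T is automatically densely defined and its adjoint satisfies T* = S. -/
/- STATEMENT 0: If `S : H →ₗ. K` has full range, `T : K →ₗ. H` has dense range and
`⟪S h, k⟫ = ⟪h, T k⟫` for all `h ∈ dom S`, `k ∈ dom T`, then `T` is densely defined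
and `T† = S`. -/

variable {𝕜 H K : Type*} [RCLike 𝕜]
  [NormedAddCommGroup H] [InnerProductSpace 𝕜 H] [CompleteSpace H]
  [NormedAddCommGroup K] [InnerProductSpace 𝕜 K] [CompleteSpace K]

local notation "⟪" x ", " y "⟫" => @inner 𝕜 _ _ x y

theorem sum_closable_stmt0
    (S : H →ₗ.[𝕜] K) (T : K →ₗ.[𝕜] H)
    (ha : ∀ y : K, ∃ x : S.domain, S x = y)
    (hb : Dense (Set.range fun k : T.domain => T k))
    (hc : ∀ (h : S.domain) (k : T.domain), ⟪S h, (k : K)⟫ = ⟪(h : H), T k⟫) :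
    Dense (T.domain : Set K) ∧ T.adjoint = S := by
  have hb : DenseRange fun k : T.domain => T k := hb
  have hT : Dense (T.domain : Set K) := by
    rw [Submodule.dense_iff_topologicalClosure_eq_top, Submodule.topologicalClosure_eq_top_iff,
      Submodule.eq_bot_iff]
    intro y hy
    obtain ⟨h, rfl⟩ := ha y
    have hh : (h : H) = 0 := hb.eq_of_inner_left 𝕜 fun k => by
      rw [← hc h k, inner_zero_left, Submodule.inner_left_of_mem_orthogonal k.2 hy]
    rw [show h = 0 from Subtype.ext hh, LinearPMap.map_zero]
  have hle : S ≤ T.adjoint := LinearPMap.IsFormalAdjoint.le_adjoint hT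
    (LinearPMap.IsFormalAdjoint.symm hc)
  refine ⟨hT, (LinearPMap.eq_of_le_of_domain_eq hle (le_antisymm hle.1 fun y hy => ?_)).symm⟩
  obtain ⟨h, hh⟩ := ha (T.adjoint ⟨y, hy⟩)
  have hyh : y = h := hb.eq_of_inner_left 𝕜 fun k => by
    rw [← hc h k, hh]
    exact (LinearPMap.adjoint_isFormalAdjoint hT ⟨y, hy⟩ k).symm
  exact hyh ▸ h.2
end

section
/- Let H₁, H₂, H₃, H₄ be Hilbert spaces and let A : H₁ → H₄, B : H₂ → H₃, C : H₃ → H₂ and D : H₄ → H₁ be (not necessarily densely defined) linear operators. If (a) the set {(x₂ + A x₁, x₁ − B x₂) : x₁ ∈ dom A, x₂ ∈ dom B} equals all of H₄ × H₃, (b) the set {(x₄ − C x₃, D x₄ + x₃) : x₃ ∈ dom C, x₄ ∈ dom D} is dense in H₂ × H₁, and (c) ⟨A x₁, x₄⟩ = ⟨x₁, D x₄⟩ for all x₁ ∈ dom A, x₄ ∈ dom D, and ⟨B x₂, x₃⟩ = ⟨x₂, C x₃⟩ for all x₂ ∈ dom B, x₃ ∈ dom C, then C and D are densely defined and their adjoints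 satisfy D* = A and C* = B. -/
namespace LinearPMap

/-- If the block operators with rows `(I, A)`, `(-B, I)` and `(I, -C)`, `(D, I)` have full and dense
range respectively, then every pair of elements in the adjoint relations of `D` and `C` lies in the
graphs of `A` and `B`. -/
theorem mem_graph_and_mem_graph_of_dense_range {𝕜 E F : Type*} [RCLike 𝕜]
    [NormedAddCommGroup E] [InnerProductSpace 𝕜 E]
    [NormedAddCommGroup F] [InnerProductSpace 𝕜 F]
    {A : E →ₗ.[𝕜] F} {B : F →ₗ.[𝕜] E} {C : E →ₗ.[𝕜] F} {D : F →ₗ.[𝕜] E}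
    (hAB : ∀ z : F × E, ∃ (x₁ : A.domain) (x₂ : B.domain),
      ((x₂ : F) + A x₁, (x₁ : E) - B x₂) = z)
    (hCD : Dense {z : F × E | ∃ (x₃ : C.domain) (x₄ : D.domain),
      ((x₄ : F) - C x₃, D x₄ + (x₃ : E)) = z})
    (hAD : A.IsFormalAdjoint D) (hBC : B.IsFormalAdjoint C) {e e' : E} {f f' : F}
    (hD : ∀ x : D.domain, inner 𝕜 f (x : F) = inner 𝕜 e (D x))
    (hC : ∀ x : C.domain, inner 𝕜 e' (x : E) = inner 𝕜 f' (C x)) :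
    (e, f) ∈ A.graph ∧ (f', e') ∈ B.graph := by
  obtain ⟨x₁, x₂, h⟩ := hAB (f' + f, e - e')
  obtain ⟨hF, hE⟩ := Prod.mk.inj h
  have hg : f' - x₂ = -(f - A x₁) := by
    rw [neg_sub, sub_eq_sub_iff_add_eq_add, ← hF, add_comm]
  have hh : e' - B x₂ = e - x₁ := by
    rw [eq_sub_iff_add_eq, ← sub_add_cancel e e', ← hE]
    abel
  have key : ∀ z : F × E, inner 𝕜 (e - x₁) z.2 = inner 𝕜 (f - A x₁) z.1 := by
    refine congrFun (Continuous.ext_on hCD (continuous_const.inner continuous_snd)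
      (continuous_const.inner continuous_fst) ?_)
    rintro _ ⟨x₃, x₄, rfl⟩
    have h₃ : inner 𝕜 (e - x₁) (x₃ : E) = -inner 𝕜 (f - A x₁) (C x₃) := by
      rw [← hh, ← inner_neg_left, ← hg, inner_sub_left, inner_sub_left, hC, hBC]
    have h₄ : inner 𝕜 (f - A x₁) (x₄ : F) = inner 𝕜 (e - x₁) (D x₄) := by
      rw [inner_sub_left, inner_sub_left, hD, hAD]
    beta_reduce
    rw [inner_add_right, inner_sub_right, h₃, h₄, ← sub_eq_add_neg]
  have he : e - x₁ = 0 := by simpa using key (0, e - x₁)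
  have hf : f - A x₁ = 0 := by simpa using (key (f - A x₁, 0)).symm
  rw [hf, neg_zero] at hg
  rw [he] at hh
  exact ⟨(A.mem_graph_iff).2 ⟨x₁, (sub_eq_zero.1 he).symm, (sub_eq_zero.1 hf).symm⟩,
    (B.mem_graph_iff).2 ⟨x₂, (sub_eq_zero.1 hg).symm, (sub_eq_zero.1 hh).symm⟩⟩

end LinearPMap

theorem Submodule.dense_of_forall_inner_eq_zero {𝕜 E : Type*} [RCLike 𝕜]
    [NormedAddCommGroup E] [InnerProductSpace 𝕜 E] [CompleteSpace E] {K : Submodule 𝕜 E}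
    (h : ∀ v, (∀ x ∈ K, inner 𝕜 v x = 0) → v = 0) : Dense (K : Set E) := by
  rw [Submodule.dense_iff_topologicalClosure_eq_top, Submodule.topologicalClosure_eq_top_iff,
    Submodule.eq_bot_iff]
  exact fun v hv => h v fun x hx => (Submodule.mem_orthogonal' K v).1 hv x hx

/-- A formal adjoint `A` of `D` whose graph contains the adjoint relation of `D` is the adjoint of
`D`, and `D` is then densely defined. -/
theorem LinearPMap.IsFormalAdjoint.dense_and_adjoint_eq {𝕜 E F : Type*} [RCLike 𝕜]
    [NormedAddCommGroup E] [InnerProductSpace 𝕜 E]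
    [NormedAddCommGroup F] [InnerProductSpace 𝕜 F] [CompleteSpace F]
    {A : E →ₗ.[𝕜] F} {D : F →ₗ.[𝕜] E} (hAD : A.IsFormalAdjoint D)
    (h : ∀ e f, (∀ x : D.domain, inner 𝕜 f (x : F) = inner 𝕜 e (D x)) → (e, f) ∈ A.graph) :
    Dense (D.domain : Set F) ∧ D.adjoint = A := by
  have hdense : Dense (D.domain : Set F) := Submodule.dense_of_forall_inner_eq_zero fun v hv =>
    A.graph_fst_eq_zero_snd (h 0 v fun x => by rw [hv x x.2, inner_zero_left]) rfl
  refine ⟨hdense, le_antisymm (LinearPMap.le_of_le_graph ?_) (hAD.symm.le_adjoint hdense)⟩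
  rintro ⟨e, f⟩ hef
  obtain ⟨y, rfl, rfl⟩ := (LinearPMap.mem_graph_iff _).1 hef
  exact h _ _ (LinearPMap.adjoint_isFormalAdjoint hdense y)


/- STATEMENT 1: Theorem 2 of the paper. The block operator with rows `(I, A)`, `(-B, I)`
maps `H₂ × H₁` into `H₄ × H₃`; for the identity entries to make sense we must have
`H₂ = H₄ =: F` and `H₁ = H₃ =: E`.  So `A : H₁ → H₄` is `A : E →ₗ. F`,
`B : H₂ → H₃` is `B : F →ₗ. E`, `C : H₃ → H₂` is `C : E →ₗ. F` and
`D : H₄ → H₁` is `D : F →ₗ. E`.  If the range of the first block operator is all of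
`H₄ × H₃ = F × E`, the range of the second one is dense in `H₂ × H₁ = F × E`, and
`⟪A x₁, x₄⟫ = ⟪x₁, D x₄⟫`, `⟪B x₂, x₃⟫ = ⟪x₂, C x₃⟫`, then `C, D` are densely
defined with `D† = A` and `C† = B`. -/

variable {𝕜 E F : Type*} [RCLike 𝕜]
  [NormedAddCommGroup E] [InnerProductSpace 𝕜 E] [CompleteSpace E]
  [NormedAddCommGroup F] [InnerProductSpace 𝕜 F] [CompleteSpace F]

local notation "⟪" x ", " y "⟫" => @inner 𝕜 _ _ x y

theorem sum_closable_stmt1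
    (A : E →ₗ.[𝕜] F) (B : F →ₗ.[𝕜] E) (C : E →ₗ.[𝕜] F) (D : F →ₗ.[𝕜] E)
    (ha : ∀ z : F × E, ∃ (x₁ : A.domain) (x₂ : B.domain),
      ((x₂ : F) + A x₁, (x₁ : E) - B x₂) = z)
    (hb : Dense {z : F × E | ∃ (x₃ : C.domain) (x₄ : D.domain),
      ((x₄ : F) - C x₃, D x₄ + (x₃ : E)) = z})
    (hc₁ : ∀ (x₁ : A.domain) (x₄ : D.domain), ⟪A x₁, (x₄ : F)⟫ = ⟪(x₁ : E), D x₄⟫)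
    (hc₂ : ∀ (x₂ : B.domain) (x₃ : C.domain), ⟪B x₂, (x₃ : E)⟫ = ⟪(x₂ : F), C x₃⟫) :
    Dense (C.domain : Set E) ∧ Dense (D.domain : Set F) ∧
      D.adjoint = A ∧ C.adjoint = B := by
  have hD := LinearPMap.IsFormalAdjoint.dense_and_adjoint_eq hc₁ fun e f h =>
    (LinearPMap.mem_graph_and_mem_graph_of_dense_range (e' := 0) (f' := 0) ha hb hc₁ hc₂ h
      (by simp)).1
  have hC := LinearPMap.IsFormalAdjoint.dense_and_adjoint_eq hc₂ fun f e h =>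
    (LinearPMap.mem_graph_and_mem_graph_of_dense_range (e := 0) (f := 0) ha hb hc₁ hc₂
      (by simp) h).2
  exact ⟨hC.1, hD.1, hD.2, hC.2⟩
end

section
/- Let H and K be Hilbert spaces and let A be a linear operator from H to K and B a linear operator from K to H. The following statements are equivalent: (i) B is a densely defined closable operator with adjoint B* = A; (ii) A is a densely defined closed operator such that ⟨Ax, y⟩ = ⟨x, By⟩ for all x ∈ dom A, y ∈ dom B, and the set {(y + A x, x − B y) : x ∈ dom A, y ∈ dom B} is dense in K × H. -/
/- STATEMENT 2: Theorem 4 of the paper. For `A : H →ₗ. K` and `B : K →ₗ. H`: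
`B` is densely defined and closable with `B† = A` iff `A` is densely defined and
closed, `⟪A x, y⟫ = ⟪x, B y⟫` on the domains, and the range of the block operator
`(y, x) ↦ (y + A x, x - B y)` is dense in `K × H`. -/

namespace LinearPMap

/-- The equivalence `(y, x) ↦ (y, -x)` from `K × H` onto the Hilbert sum of `K` and `H`. -/
noncomputable def negSndL2 (𝕜 H K : Type*) [RCLike 𝕜]
    [NormedAddCommGroup H] [InnerProductSpace 𝕜 H]
    [NormedAddCommGroup K] [InnerProductSpace 𝕜 K] : (K × H) ≃L[𝕜] WithLp 2 (K × H) :=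
  ((ContinuousLinearEquiv.refl 𝕜 K).prodCongr (ContinuousLinearEquiv.neg 𝕜)).trans
    (WithLp.prodContinuousLinearEquiv 2 𝕜 K H).symm

/-- The equivalence `(x, y) ↦ (y, x)` from `H × K` onto the Hilbert sum of `K` and `H`. -/
noncomputable def swapL2 (𝕜 H K : Type*) [RCLike 𝕜]
    [NormedAddCommGroup H] [InnerProductSpace 𝕜 H]
    [NormedAddCommGroup K] [InnerProductSpace 𝕜 K] : (H × K) ≃L[𝕜] WithLp 2 (K × H) :=
  (ContinuousLinearEquiv.prodComm 𝕜 H K).trans (WithLp.prodContinuousLinearEquiv 2 𝕜 K H).symm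

section

variable {𝕜 H K : Type*} [RCLike 𝕜]
  [NormedAddCommGroup H] [InnerProductSpace 𝕜 H]
  [NormedAddCommGroup K] [InnerProductSpace 𝕜 K]

/-- The set of all `(y, -B y)`, in the Hilbert sum. -/
noncomputable def negGraph (B : K →ₗ.[𝕜] H) : Submodule 𝕜 (WithLp 2 (K × H)) :=
  B.graph.map (negSndL2 𝕜 H K : (K × H) →ₗ[𝕜] WithLp 2 (K × H))

/-- The set of all `(A x, x)`, in the Hilbert sum. -/
noncomputable def swapGraph (A : H →ₗ.[𝕜] K) : Submodule 𝕜 (WithLp 2 (K × H)) :=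
  A.graph.map (swapL2 𝕜 H K : (H × K) →ₗ[𝕜] WithLp 2 (K × H))

theorem mem_negGraph {B : K →ₗ.[𝕜] H} {w : WithLp 2 (K × H)} :
    w ∈ B.negGraph ↔ ∃ y : B.domain, WithLp.toLp 2 ((y : K), -B y) = w := by
  simp only [negGraph, Submodule.mem_map]
  constructor
  · rintro ⟨p, hp, rfl⟩
    obtain ⟨y, hy⟩ := (mem_graph_iff' B).1 hp
    exact ⟨y, by rw [← hy]; rfl⟩
  · rintro ⟨y, rfl⟩
    exact ⟨_, B.mem_graph y, rfl⟩

theorem mem_swapGraph {A : H →ₗ.[𝕜] K} {w : WithLp 2 (K × H)} :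
    w ∈ A.swapGraph ↔ ∃ x : A.domain, WithLp.toLp 2 (A x, (x : H)) = w := by
  simp only [swapGraph, Submodule.mem_map]
  constructor
  · rintro ⟨p, hp, rfl⟩
    obtain ⟨x, hx⟩ := (mem_graph_iff' A).1 hp
    exact ⟨x, by rw [← hx]; rfl⟩
  · rintro ⟨x, rfl⟩
    exact ⟨_, A.mem_graph x, rfl⟩

theorem mem_graph_iff_mem_swapGraph {A : H →ₗ.[𝕜] K} {p : H × K} :
    p ∈ A.graph ↔ WithLp.toLp 2 (p.2, p.1) ∈ A.swapGraph :=
  (Submodule.mem_map_equiv (e := (swapL2 𝕜 H K).toLinearEquiv)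
    (x := WithLp.toLp 2 (p.2, p.1)) A.graph).symm

theorem mem_orthogonal_negGraph {B : K →ₗ.[𝕜] H} {w : WithLp 2 (K × H)} :
    w ∈ B.negGraphᗮ ↔ ∀ y : B.domain, inner 𝕜 (y : K) w.fst = inner 𝕜 (B y) w.snd := by
  simp only [Submodule.mem_orthogonal, mem_negGraph, forall_exists_index,
    forall_apply_eq_imp_iff, WithLp.prod_inner_apply]
  simp [← sub_eq_add_neg, sub_eq_zero]

theorem mem_orthogonal_swapGraph {A : H →ₗ.[𝕜] K} {w : WithLp 2 (K × H)} :
    w ∈ A.swapGraphᗮ ↔ ∀ x : A.domain, inner 𝕜 (A x) w.fst + inner 𝕜 (x : H) w.snd = 0 := by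
  simp only [Submodule.mem_orthogonal, mem_swapGraph, forall_exists_index,
    forall_apply_eq_imp_iff, WithLp.prod_inner_apply]
  rfl

theorem IsClosed.isClosed_swapGraph {A : H →ₗ.[𝕜] K} (hA : A.IsClosed) :
    _root_.IsClosed (A.swapGraph : Set (WithLp 2 (K × H))) :=
  (swapL2 𝕜 H K).isClosed_image.2 hA

theorem graph_adjoint_eq_iff_orthogonal_negGraph_eq {A : H →ₗ.[𝕜] K} {B : K →ₗ.[𝕜] H} :
    B.graph.adjoint = A.graph ↔ B.negGraphᗮ = A.swapGraph := by
  have h (p : H × K) : p ∈ B.graph.adjoint ↔ WithLp.toLp 2 (p.2, p.1) ∈ B.negGraphᗮ := by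
    rw [Submodule.mem_adjoint_iff, mem_orthogonal_negGraph]
    constructor
    · exact fun hp y => (sub_eq_zero.1 (hp _ _ (B.mem_graph y))).symm
    · intro hp a b hab
      obtain ⟨y, rfl, rfl⟩ := (mem_graph_iff B).1 hab
      exact sub_eq_zero.2 (hp y).symm
  simp only [SetLike.ext_iff, h, mem_graph_iff_mem_swapGraph]
  exact ⟨fun hp w => hp (w.snd, w.fst), fun hw p => hw _⟩

variable [CompleteSpace K]

theorem dense_domain_of_graph_adjoint_eq {A : H →ₗ.[𝕜] K} {B : K →ₗ.[𝕜] H}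
    (h : B.graph.adjoint = A.graph) : Dense (B.domain : Set K) := by
  rw [Submodule.dense_iff_topologicalClosure_eq_top, Submodule.topologicalClosure_eq_top_iff,
    Submodule.eq_bot_iff]
  intro k hk
  have hmem : ((0 : H), k) ∈ A.graph := by
    rw [← h, Submodule.mem_adjoint_iff]
    intro a b hab
    have ha : a ∈ B.domain := B.mem_domain_of_mem_graph hab
    simpa using Submodule.inner_right_of_mem_orthogonal ha hk
  exact A.graph_fst_eq_zero_snd hmem rfl

variable [CompleteSpace H]

theorem dense_blockRange_iff {A : H →ₗ.[𝕜] K} {B : K →ₗ.[𝕜] H} :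
    Dense {z : K × H | ∃ (x : A.domain) (y : B.domain), ((y : K) + A x, (x : H) - B y) = z} ↔
      B.negGraphᗮ ⊓ A.swapGraphᗮ = ⊥ := by
  rw [Submodule.inf_orthogonal, ← Submodule.topologicalClosure_eq_top_iff,
    ← Submodule.dense_iff_topologicalClosure_eq_top,
    ← (WithLp.prodContinuousLinearEquiv 2 𝕜 K H).symm.toHomeomorph.isDenseEmbedding.dense_image]
  congr! 1
  ext w
  simp only [Set.mem_image, SetLike.mem_coe, Submodule.mem_sup, mem_negGraph, mem_swapGraph]
  constructor
  · rintro ⟨_, ⟨x, y, rfl⟩, rfl⟩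
    refine ⟨_, ⟨y, rfl⟩, _, ⟨x, rfl⟩, ?_⟩
    rw [← WithLp.toLp_add, Prod.mk_add_mk, neg_add_eq_sub]
    rfl
  · rintro ⟨_, ⟨y, rfl⟩, _, ⟨x, rfl⟩, rfl⟩
    refine ⟨_, ⟨x, y, rfl⟩, ?_⟩
    rw [← WithLp.toLp_add, Prod.mk_add_mk, neg_add_eq_sub]
    rfl

/-- The adjoint of a densely defined closable operator is densely defined. -/
theorem IsClosable.dense_adjoint_domain {B : K →ₗ.[𝕜] H} (hd : Dense (B.domain : Set K))
    (hB : B.IsClosable) : Dense (B.adjoint.domain : Set H) := by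
  have hgraph : B.negGraphᗮ = B.adjoint.swapGraph :=
    graph_adjoint_eq_iff_orthogonal_negGraph_eq.1 (adjoint_graph_eq_graph_adjoint hd).symm
  rw [Submodule.dense_iff_topologicalClosure_eq_top, Submodule.topologicalClosure_eq_top_iff,
    Submodule.eq_bot_iff]
  intro z hz
  obtain ⟨f, hf⟩ := hB
  have hmem : WithLp.toLp 2 ((0 : K), z) ∈ B.adjoint.swapGraphᗮ :=
    mem_orthogonal_swapGraph.2 fun x => by
      simpa using Submodule.inner_right_of_mem_orthogonal x.2 hz
  rw [← hgraph, Submodule.orthogonal_orthogonal_eq_closure, ← SetLike.mem_coe,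
    Submodule.topologicalClosure_coe] at hmem
  have himage := (negSndL2 𝕜 H K).image_closure (B.graph : Set (K × H))
  have hclosure : ((0 : K), -z) ∈ f.graph := by
    rw [← hf, ← SetLike.mem_coe, Submodule.topologicalClosure_coe]
    obtain ⟨p, hp, hpz⟩ := himage.symm.subset hmem
    have : p = (0, -z) := (negSndL2 𝕜 H K).injective (hpz.trans (by simp [negSndL2]))
    exact this ▸ hp
  exact neg_eq_zero.1 (f.graph_fst_eq_zero_snd hclosure rfl)

theorem IsFormalAdjoint.orthogonal_negGraph_eq {A : H →ₗ.[𝕜] K} {B : K →ₗ.[𝕜] H}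
    (hA : A.IsClosed) (hAB : A.IsFormalAdjoint B) (h : B.negGraphᗮ ⊓ A.swapGraphᗮ = ⊥) :
    B.negGraphᗮ = A.swapGraph := by
  have hle : A.swapGraph ≤ B.negGraphᗮ := by
    intro w hw
    obtain ⟨x, rfl⟩ := mem_swapGraph.1 hw
    exact mem_orthogonal_negGraph.2 fun y => (hAB.symm y x).symm
  have : CompleteSpace A.swapGraph := hA.isClosed_swapGraph.completeSpace_coe
  have hsup := Submodule.sup_orthogonal_inf_of_hasOrthogonalProjection hle
  rw [inf_comm, h, sup_bot_eq] at hsup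
  exact hsup.symm

end

end LinearPMap

variable {𝕜 H K : Type*} [RCLike 𝕜]
  [NormedAddCommGroup H] [InnerProductSpace 𝕜 H] [CompleteSpace H]
  [NormedAddCommGroup K] [InnerProductSpace 𝕜 K] [CompleteSpace K]

local notation "⟪" x ", " y "⟫" => @inner 𝕜 _ _ x y

theorem sum_closable_stmt2
    (A : H →ₗ.[𝕜] K) (B : K →ₗ.[𝕜] H) :
    (Dense (B.domain : Set K) ∧ B.IsClosable ∧ B.adjoint = A) ↔
      (Dense (A.domain : Set H) ∧ A.IsClosed ∧
        (∀ (x : A.domain) (y : B.domain), ⟪A x, (y : K)⟫ = ⟪(x : H), B y⟫) ∧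
        Dense {z : K × H | ∃ (x : A.domain) (y : B.domain),
          ((y : K) + A x, (x : H) - B y) = z}) := by
  constructor
  · rintro ⟨hd, hB, rfl⟩
    have hgraph : B.negGraphᗮ = B.adjoint.swapGraph :=
      LinearPMap.graph_adjoint_eq_iff_orthogonal_negGraph_eq.1
        (LinearPMap.adjoint_graph_eq_graph_adjoint hd).symm
    refine ⟨hB.dense_adjoint_domain hd, LinearPMap.adjoint_isClosed hd,
      LinearPMap.adjoint_isFormalAdjoint hd, LinearPMap.dense_blockRange_iff.2 ?_⟩
    rw [hgraph, Submodule.inf_orthogonal_eq_bot]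
  · rintro ⟨hd, hA, hAB, hdense⟩
    have hgraph : B.graph.adjoint = A.graph :=
      LinearPMap.graph_adjoint_eq_iff_orthogonal_negGraph_eq.2
        (LinearPMap.IsFormalAdjoint.orthogonal_negGraph_eq hA hAB
          (LinearPMap.dense_blockRange_iff.1 hdense))
    have hB := LinearPMap.dense_domain_of_graph_adjoint_eq hgraph
    refine ⟨hB, LinearPMap.isClosable_iff_exists_closed_extension.2
      ⟨A.adjoint, LinearPMap.adjoint_isClosed hd, ?_⟩, LinearPMap.eq_of_eq_graph ?_⟩
    · exact LinearPMap.IsFormalAdjoint.le_adjoint hd (T := A) hAB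
    · rw [LinearPMap.adjoint_graph_eq_graph_adjoint hB, hgraph]
end

section
/- Let A be a densely defined closed linear operator from a Hilbert space H to a Hilbert space K. Then the map (y, x) ↦ (y + A x, x − A* y), defined for x ∈ dom A and y ∈ dom A*, is surjective onto K × H; that is, every element of K × H can be written as (y + A x, x − A* y) with x ∈ dom A, y ∈ dom A*. -/
/- STATEMENT 3: For a densely defined closed operator `A : H →ₗ. K`, the map
`(y, x) ↦ (y + A x, x - A† y)` (with `x ∈ dom A`, `y ∈ dom A†`) is onto `K × H`. -/

variable {𝕜 H K : Type*} [RCLike 𝕜]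
  [NormedAddCommGroup H] [InnerProductSpace 𝕜 H] [CompleteSpace H]
  [NormedAddCommGroup K] [InnerProductSpace 𝕜 K] [CompleteSpace K]

theorem sum_closable_stmt3
    (A : H →ₗ.[𝕜] K) (hdense : Dense (A.domain : Set H)) (hclosed : A.IsClosed) :
    ∀ z : K × H, ∃ (x : A.domain) (y : A.adjoint.domain),
      ((y : K) + A x, (x : H) - A.adjoint y) = z := by
  rintro ⟨k, h⟩
  let G : Submodule 𝕜 (WithLp 2 (H × K)) :=
    A.graph.comap (WithLp.linearEquiv 2 𝕜 (H × K)).toLinearMap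
  have hG : IsClosed (G : Set (WithLp 2 (H × K))) :=
    IsClosed.preimage (WithLp.prod_continuous_ofLp 2 H K) hclosed
  have : CompleteSpace G := hG.completeSpace_coe
  obtain ⟨p, hp, q, hq, hpq⟩ := G.exists_add_mem_mem_orthogonal (WithLp.toLp 2 (h, k))
  obtain ⟨x, hx, hAx⟩ := (LinearPMap.mem_graph_iff A).1 hp
  have hadj : ∀ a : A.domain, inner 𝕜 (-q.fst) (a : H) = inner 𝕜 q.snd (A a) := fun a => by
    have := (Submodule.mem_orthogonal' G q).1 hq (WithLp.toLp 2 ((a : H), A a)) (A.mem_graph a)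
    rw [inner_neg_left, neg_eq_iff_add_eq_zero]
    exact this
  have hy : q.snd ∈ A.adjoint.domain :=
    LinearPMap.mem_adjoint_domain_of_exists _ ⟨-q.fst, hadj⟩
  refine ⟨x, ⟨q.snd, hy⟩, ?_⟩
  rw [LinearPMap.adjoint_apply_eq hdense ⟨q.snd, hy⟩ hadj, hx, hAx, sub_neg_eq_add]
  have hfst : h = p.fst + q.fst := congrArg WithLp.fst hpq
  have hsnd : k = p.snd + q.snd := congrArg WithLp.snd hpq
  rw [hfst, hsnd, add_comm p.snd]
  rfl
end

section
/- Let S be a linear operator acting in a (real or complex) Hilbert space H. The following are equivalent: (i) S is essentially selfadjoint; (ii) S is densely defined, symmetric, and the set {(h + S k, k − S h) : h, k ∈ dom S} is dense in H × H. -/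
/- STATEMENT 6: Corollary 6 of the paper. `S` is essentially selfadjoint iff `S` is
densely defined, symmetric and the set `{(h + S k, k - S h) : h, k ∈ dom S}` is
dense in `H × H`. -/

variable {𝕜 H : Type*} [RCLike 𝕜]
  [NormedAddCommGroup H] [InnerProductSpace 𝕜 H] [CompleteSpace H]

local notation "⟪" x ", " y "⟫" => @inner 𝕜 _ _ x y

/-- A densely defined operator is essentially selfadjoint if it is closable and its
closure is selfadjoint. -/
def LinearPMap.IsEssentiallySelfAdjoint (S : H →ₗ.[𝕜] H) : Prop :=
  Dense (S.domain : Set H) ∧ S.IsClosable ∧ IsSelfAdjoint S.closure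

/-- Orthogonal decomposition of a point of a product of Hilbert spaces along the closure of a
submodule, with respect to the `L²` inner product. -/
theorem Submodule.exists_mem_topologicalClosure_prod_orthogonal {E F : Type*}
    [NormedAddCommGroup E] [InnerProductSpace 𝕜 E] [CompleteSpace E]
    [NormedAddCommGroup F] [InnerProductSpace 𝕜 F] [CompleteSpace F]
    (K : Submodule 𝕜 (E × F)) (p : E × F) :
    ∃ c ∈ K.topologicalClosure, ∀ k ∈ K,
      inner 𝕜 k.1 (p - c).1 + inner 𝕜 k.2 (p - c).2 = 0 := by
  let L : Submodule 𝕜 (WithLp 2 (E × F)) :=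
    K.topologicalClosure.comap (WithLp.linearEquiv 2 𝕜 (E × F)).toLinearMap
  have hL : IsClosed (L : Set (WithLp 2 (E × F))) :=
    K.isClosed_topologicalClosure.preimage (WithLp.prod_continuous_ofLp 2 E F)
  have : CompleteSpace L := hL.completeSpace_coe
  obtain ⟨c, hc, q, hq, hcq⟩ := L.exists_add_mem_mem_orthogonal (WithLp.toLp 2 p)
  refine ⟨WithLp.ofLp c, hc, fun k hk => ?_⟩
  have hpc : p - WithLp.ofLp c = WithLp.ofLp q := by
    rw [sub_eq_iff_eq_add', ← WithLp.ofLp_add, ← hcq]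
  rw [hpc]
  exact (L.mem_orthogonal q).1 hq (WithLp.toLp 2 k) (K.le_topologicalClosure hk)

theorem Submodule.adjoint_topologicalClosure {E F : Type*}
    [NormedAddCommGroup E] [InnerProductSpace 𝕜 E]
    [NormedAddCommGroup F] [InnerProductSpace 𝕜 F] (g : Submodule 𝕜 (E × F)) :
    g.topologicalClosure.adjoint = g.adjoint := by
  ext x
  simp only [Submodule.mem_adjoint_iff]
  refine ⟨fun h a b hab => h a b (g.le_topologicalClosure hab), fun h a b hab => ?_⟩
  have hclosed : IsClosed {p : E × F | inner 𝕜 p.2 x.1 - inner 𝕜 p.1 x.2 = 0} :=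
    isClosed_eq (by fun_prop) continuous_const
  exact closure_minimal (fun p hp => h p.1 p.2 hp) hclosed hab

namespace LinearPMap

theorem adjoint_closure {S : H →ₗ.[𝕜] H} (hd : Dense (S.domain : Set H)) (hS : S.IsClosable) :
    S.closure.adjoint = S.adjoint := by
  apply eq_of_eq_graph
  rw [adjoint_graph_eq_graph_adjoint (hd.mono S.le_closure.1),
    adjoint_graph_eq_graph_adjoint hd, ← hS.graph_closure_eq_closure_graph,
    Submodule.adjoint_topologicalClosure]

/-- The submodule of all `(h + S k, k - S h)` with `h` and `k` in the domain of `S`. -/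
def skewRange {E : Type*} [NormedAddCommGroup E] [InnerProductSpace 𝕜 E] (S : E →ₗ.[𝕜] E) :
    Submodule 𝕜 (E × E) :=
  LinearMap.range
    ((S.domain.subtype.coprod S.toFun).prod ((-S.toFun).coprod S.domain.subtype))

theorem mem_skewRange_iff {E : Type*} [NormedAddCommGroup E] [InnerProductSpace 𝕜 E]
    {S : E →ₗ.[𝕜] E} {z : E × E} :
    z ∈ S.skewRange ↔ ∃ h k : S.domain, ((h : E) + S k, (k : E) - S h) = z := by
  simp [skewRange, sub_eq_neg_add]

theorem mem_adjoint_graph_iff {S : H →ₗ.[𝕜] H} (hd : Dense (S.domain : Set H)) (x : H × H) :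
    x ∈ S.adjoint.graph ↔ ∀ h : S.domain, ⟪S h, x.1⟫ = ⟪(h : H), x.2⟫ := by
  rw [adjoint_graph_eq_graph_adjoint hd, Submodule.mem_adjoint_iff]
  simp only [sub_eq_zero]
  refine ⟨fun hx h => hx _ _ (S.mem_graph h), fun hx a b hab => ?_⟩
  obtain ⟨h, rfl, rfl⟩ := (S.mem_graph_iff).1 hab
  exact hx h

/-- Orthogonality to `S.skewRange`, in terms of the adjoint of `S`. -/
theorem forall_mem_skewRange_inner_eq_zero_iff {S : H →ₗ.[𝕜] H}
    (hd : Dense (S.domain : Set H)) (u v : H) :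
    (∀ z ∈ S.skewRange, ⟪z.1, u⟫ + ⟪z.2, v⟫ = 0) ↔
      (v, u) ∈ S.adjoint.graph ∧ (u, -v) ∈ S.adjoint.graph := by
  simp only [mem_skewRange_iff, mem_adjoint_graph_iff hd]
  constructor
  · intro hz
    refine ⟨fun h => ?_, fun k => ?_⟩
    · have := hz _ ⟨h, 0, rfl⟩
      simp only [map_zero, ZeroMemClass.coe_zero, add_zero, zero_sub, inner_neg_left] at this
      linear_combination -this
    · have := hz _ ⟨0, k, rfl⟩
      simp only [map_zero, ZeroMemClass.coe_zero, zero_add, sub_zero] at this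
      rw [inner_neg_right]
      linear_combination this
  · rintro ⟨hv, hu⟩ _ ⟨h, k, rfl⟩
    have h1 := hv h
    have h2 := hu k
    simp only [inner_neg_right] at h2
    simp only [inner_add_left, inner_sub_left]
    linear_combination h2 - h1

/-- If `S` is densely defined and `S.skewRange` is dense, then every element of the graph of the
adjoint is a limit of elements of the graph of `S`, provided `S` is contained in its adjoint. -/
theorem adjoint_graph_le_topologicalClosure_graph {S : H →ₗ.[𝕜] H}
    (hd : Dense (S.domain : Set H)) (hS : S ≤ S.adjoint)
    (hR : Dense (S.skewRange : Set (H × H))) :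
    S.adjoint.graph ≤ S.graph.topologicalClosure := by
  intro p hp
  obtain ⟨c, hc, hort⟩ := S.graph.exists_mem_topologicalClosure_prod_orthogonal p
  have hc' : c ∈ S.adjoint.graph :=
    S.graph.topologicalClosure_minimal (le_graph_of_le hS) (adjoint_isClosed hd) hc
  generalize hq : p - c = q at hort
  have hq1 : (q.1, q.2) ∈ S.adjoint.graph := hq ▸ sub_mem hp hc'
  have hq2 : (q.2, -q.1) ∈ S.adjoint.graph := by
    rw [mem_adjoint_graph_iff hd]
    intro h
    have := hort _ (S.mem_graph h)
    rw [inner_neg_right]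
    linear_combination this
  have hz := (forall_mem_skewRange_inner_eq_zero_iff hd q.2 q.1).2 ⟨hq1, hq2⟩
  have hclosed : _root_.IsClosed {z : H × H | ⟪z.1, q.2⟫ + ⟪z.2, q.1⟫ = 0} :=
    isClosed_eq (by fun_prop) continuous_const
  have hall (z : H × H) : ⟪z.1, q.2⟫ + ⟪z.2, q.1⟫ = 0 :=
    closure_minimal (fun z hz' => hz z hz') hclosed (hR z)
  have h1 : q.1 = 0 := by simpa using hall (0, q.1)
  have h2 : q.2 = 0 := by simpa using hall (q.2, 0)
  have : p - c = 0 := hq.trans (Prod.ext h1 h2)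
  rwa [sub_eq_zero.1 this]

theorem IsEssentiallySelfAdjoint.dense_skewRange {S : H →ₗ.[𝕜] H}
    (hS : S.IsEssentiallySelfAdjoint) : Dense (S.skewRange : Set (H × H)) := by
  obtain ⟨hd, hcl, hsa⟩ := hS
  have hadj : S.adjoint = S.closure := (adjoint_closure hd hcl).symm.trans hsa
  have hT : S.closure.IsFormalAdjoint S.closure := by
    have := adjoint_isFormalAdjoint hsa.dense_domain
    rwa [isSelfAdjoint_def.1 hsa] at this
  intro p
  obtain ⟨c, hc, hort⟩ := S.skewRange.exists_mem_topologicalClosure_prod_orthogonal p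
  generalize hq : p - c = q at hort
  obtain ⟨hv, hu⟩ := (forall_mem_skewRange_inner_eq_zero_iff hd q.1 q.2).1 hort
  rw [hadj, mem_graph_iff] at hv hu
  obtain ⟨v, hv1, hv2⟩ := hv
  obtain ⟨u, hu1, hu2⟩ := hu
  have key := hT v u
  simp only at hv1 hv2 hu1 hu2
  rw [hv1, hv2, hu1, hu2, inner_neg_right, inner_self_eq_norm_sq_to_K,
    inner_self_eq_norm_sq_to_K] at key
  have key' : ‖q.1‖ ^ 2 = -‖q.2‖ ^ 2 := by exact_mod_cast key
  have h1 : q.1 = 0 := by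
    rw [← norm_eq_zero]; nlinarith [sq_nonneg ‖q.1‖, sq_nonneg ‖q.2‖]
  have h2 : q.2 = 0 := by
    rw [← norm_eq_zero]; nlinarith [sq_nonneg ‖q.1‖, sq_nonneg ‖q.2‖]
  have : p - c = 0 := hq.trans (Prod.ext h1 h2)
  rw [sub_eq_zero.1 this]
  exact hc

end LinearPMap

theorem sum_closable_stmt6 (S : H →ₗ.[𝕜] H) :
    S.IsEssentiallySelfAdjoint ↔
      (Dense (S.domain : Set H) ∧
        (∀ x y : S.domain, ⟪S x, (y : H)⟫ = ⟪(x : H), S y⟫) ∧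
        Dense {z : H × H | ∃ h k : S.domain, ((h : H) + S k, (k : H) - S h) = z}) := by
  simp only [← LinearPMap.mem_skewRange_iff]
  constructor
  · intro h
    refine ⟨h.1, fun x y => ?_, h.dense_skewRange⟩
    have hT := LinearPMap.adjoint_isFormalAdjoint h.2.2.dense_domain
    rw [LinearPMap.isSelfAdjoint_def.1 h.2.2] at hT
    have hle := S.le_closure
    have hx := hle.2 (x := x) (y := ⟨x, hle.1 x.2⟩) rfl
    have hy := hle.2 (x := y) (y := ⟨y, hle.1 y.2⟩) rfl
    rw [hx, hy]
    exact hT ⟨x, hle.1 x.2⟩ ⟨y, hle.1 y.2⟩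
  · rintro ⟨hd, hsymm, hR⟩
    have hle : S ≤ S.adjoint := LinearPMap.IsFormalAdjoint.le_adjoint hd hsymm
    have hcl : S.IsClosable := (LinearPMap.adjoint_isClosed hd).isClosable.leIsClosable hle
    refine ⟨hd, hcl, LinearPMap.isSelfAdjoint_def.2 ?_⟩
    rw [LinearPMap.adjoint_closure hd hcl]
    apply LinearPMap.eq_of_eq_graph
    rw [← hcl.graph_closure_eq_closure_graph]
    exact le_antisymm (LinearPMap.adjoint_graph_le_topologicalClosure_graph hd hle hR)
      (S.graph.topologicalClosure_minimal (LinearPMap.le_graph_of_le hle)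
        (LinearPMap.adjoint_isClosed hd))
end

section
/- Let W and Z be linear operators in a Hilbert space H with dom Z ⊆ dom W, such that ⟨Zh, k⟩ + ⟨h, Zk⟩ = 0 and ⟨Wh, k⟩ + ⟨h, Wk⟩ = 0 for all h, k ∈ dom Z (i.e. Z and the restriction of W to dom Z are skew-symmetric). Assume further that (a) Z is closable, (b) the operator T := I + Z (with domain dom Z) has dense range, and (c) ‖Wh‖² ≤ ‖Th‖² for all h ∈ dom Z. Then the operator T + W = I + Z + W (with domain dom Z) has dense range in H. -/
/- STATEMENT 7: Theorem 10 of the paper. If `Z, W` are operators in `H` with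
`dom Z ⊆ dom W`, `Z` and `W|_{dom Z}` are skew-symmetric, `Z` is closable,
`T := I + Z` has dense range and `‖W h‖² ≤ ‖T h‖²` on `dom Z`, then
`T + W = I + Z + W` (with domain `dom Z`) has dense range. -/

variable {𝕜 H : Type*} [RCLike 𝕜]
  [NormedAddCommGroup H] [InnerProductSpace 𝕜 H] [CompleteSpace H]

local notation "⟪" x ", " y "⟫" => @inner 𝕜 _ _ x y

/-- Vectors `h n` in the domain of a closable operator `f` with `h n → 0` and `f (h n) → u`
force `u = 0`. -/
theorem LinearPMap.IsClosable.eq_zero_of_tendsto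
    {K E : Type*} [RCLike K] [NormedAddCommGroup E] [InnerProductSpace K E]
    {f : E →ₗ.[K] E} (hf : f.IsClosable)
    {h : ℕ → f.domain} {u : E}
    (h0 : Filter.Tendsto (fun n => (h n : E)) Filter.atTop (nhds 0))
    (hu : Filter.Tendsto (fun n => f (h n)) Filter.atTop (nhds u)) : u = 0 := by
  obtain ⟨g, hg⟩ := hf
  have hmem : ((0 : E), u) ∈ g.graph := by
    rw [← hg]
    exact mem_closure_of_tendsto (h0.prodMk_nhds hu) (.of_forall fun n => f.mem_graph (h n))
  exact g.graph_fst_eq_zero_snd hmem rfl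

theorem re_inner_eq_zero_of_inner_add_inner_eq_zero
    {K E : Type*} [RCLike K] [NormedAddCommGroup E] [InnerProductSpace K E]
    {x y : E} (h : inner K x y + inner K y x = 0) :
    RCLike.re (inner K x y) = 0 := by
  have := congrArg RCLike.re h
  rw [map_add, inner_re_symm (𝕜 := K) y x, map_zero] at this
  linarith

/-- If `u` is orthogonal to `t + w` and `‖w‖ ≤ ‖t‖`, then `-w` is at least as close to `u`
as `t` is. -/
theorem norm_add_le_norm_sub_of_inner_eq_zero
    {K E : Type*} [RCLike K] [NormedAddCommGroup E] [InnerProductSpace K E]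
    {u t w : E} (h : inner K u (t + w) = 0)
    (hwt : ‖w‖ ^ 2 ≤ ‖t‖ ^ 2) : ‖u + w‖ ≤ ‖u - t‖ := by
  have hre := congrArg RCLike.re h
  rw [inner_add_right, map_add, map_zero] at hre
  refine le_of_sq_le_sq ?_ (norm_nonneg _)
  rw [norm_add_sq (𝕜 := K), norm_sub_sq (𝕜 := K)]
  linarith

/-- If `z` and `w` are both real-orthogonal to `h`, then `‖h‖ ≤ ‖h + z + w‖`. -/
theorem norm_le_norm_add_add_of_re_inner_eq_zero
    {K E : Type*} [RCLike K] [NormedAddCommGroup E] [InnerProductSpace K E]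
    {h z w : E} (hz : RCLike.re (inner K z h) = 0)
    (hw : RCLike.re (inner K w h) = 0) : ‖h‖ ≤ ‖h + z + w‖ := by
  have hre : RCLike.re (inner K h (z + w)) = 0 := by
    rw [inner_re_symm, inner_add_left, map_add, hz, hw, add_zero]
  refine le_of_sq_le_sq ?_ (norm_nonneg _)
  rw [add_assoc, norm_add_sq (𝕜 := K), hre]
  nlinarith [sq_nonneg ‖z + w‖]

theorem sum_closable_stmt7
    (Z W : H →ₗ.[𝕜] H) (hdom : Z.domain ≤ W.domain)
    (hZ : ∀ h k : Z.domain, ⟪Z h, (k : H)⟫ + ⟪(h : H), Z k⟫ = 0)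
    (hW : ∀ h k : Z.domain,
      ⟪W (Submodule.inclusion hdom h), (k : H)⟫ +
        ⟪(h : H), W (Submodule.inclusion hdom k)⟫ = 0)
    (ha : Z.IsClosable)
    (hb : Dense (Set.range fun h : Z.domain => (h : H) + Z h))
    (hc : ∀ h : Z.domain, ‖W (Submodule.inclusion hdom h)‖ ^ 2 ≤ ‖(h : H) + Z h‖ ^ 2) :
    Dense (Set.range fun h : Z.domain =>
      (h : H) + Z h + W (Submodule.inclusion hdom h)) := by
  let S : Z.domain →ₗ[𝕜] H :=
    Z.domain.subtype + Z.toFun + W.toFun ∘ₗ Submodule.inclusion hdom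
  change Dense (S.range : Set H)
  rw [Submodule.dense_iff_topologicalClosure_eq_top, Submodule.topologicalClosure_eq_top_iff,
    Submodule.eq_bot_iff]
  intro u hu
  have hort (h : Z.domain) :
      ⟪u, (h : H) + Z h + W (Submodule.inclusion hdom h)⟫ = 0 :=
    (Submodule.mem_orthogonal' _ _).1 hu _ ⟨h, rfl⟩
  obtain ⟨t, ht, htu⟩ := mem_closure_iff_seq_limit.1 (hb u)
  choose h hh using ht
  obtain rfl : (fun n => (h n : H) + Z (h n)) = t := funext hh
  have hbound (n : ℕ) : ‖(h n : H)‖ ≤ 2 * ‖u - ((h n : H) + Z (h n))‖ := by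
    set w := W (Submodule.inclusion hdom (h n))
    calc ‖(h n : H)‖ ≤ ‖(h n : H) + Z (h n) + w‖ :=
          norm_le_norm_add_add_of_re_inner_eq_zero
            (re_inner_eq_zero_of_inner_add_inner_eq_zero (hZ (h n) (h n)))
            (re_inner_eq_zero_of_inner_add_inner_eq_zero (hW (h n) (h n)))
      _ = ‖(u + w) - (u - ((h n : H) + Z (h n)))‖ := by congr 1; abel
      _ ≤ ‖u + w‖ + ‖u - ((h n : H) + Z (h n))‖ := norm_sub_le _ _
      _ ≤ 2 * ‖u - ((h n : H) + Z (h n))‖ := by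
          linarith [norm_add_le_norm_sub_of_inner_eq_zero (hort (h n)) (hc (h n))]
  have h0 : Filter.Tendsto (fun n => (h n : H)) Filter.atTop (nhds 0) := by
    refine squeeze_zero_norm hbound ?_
    simpa using ((tendsto_const_nhds (x := u)).sub htu).norm.const_mul 2
  exact ha.eq_zero_of_tendsto h0 (by simpa using htu.sub h0)
end

section
/- Let A, R be linear operators from a Hilbert space H to a Hilbert space K and B, S linear operators from K to H, with dom A ⊆ dom R and dom B ⊆ dom S, such that ⟨Ah, k⟩ = ⟨h, Bk⟩ for all h ∈ dom A, k ∈ dom B, and ⟨Rh, k⟩ = ⟨h, Sk⟩ for all h ∈ dom R, k ∈ dom S. Assume further that (a) A and B are closable, (b) the set {(k + A h, h − B k) : h ∈ dom A, k ∈ dom B} is dense in K × H, (c) ‖Rh‖² ≤ ‖Ah‖² + ‖h‖² for all h ∈ dom A, and (d) ‖Sk‖² ≤ ‖Bk‖² + ‖k‖² for all k ∈ dom B. Then the set {(k + (A+R)h, h − (B+S)k) : h ∈ dom A, k ∈ dom B} is dense in K × H. -/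
/- STATEMENT 8: Corollary 11 of the paper. -/

section CrossMap

open Filter Topology

/-- A perturbation `Q` dominated in norm by a map `T` of dense range preserves density of the range,
provided no nonzero vector is a simultaneous limit of `T x` and `-Q x`. -/
theorem denseRange_add_of_norm_le {𝕜 X E : Type*} [RCLike 𝕜] [AddCommGroup X] [Module 𝕜 X]
    [NormedAddCommGroup E] [InnerProductSpace 𝕜 E] [CompleteSpace E]
    (T Q : X →ₗ[𝕜] E) (hT : DenseRange T) (hQT : ∀ x, ‖Q x‖ ≤ ‖T x‖)
    (hlim : ∀ (x : ℕ → X) (v : E), Tendsto (fun n => T (x n)) atTop (𝓝 v) →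
      Tendsto (fun n => Q (x n)) atTop (𝓝 (-v)) → v = 0) :
    DenseRange (T + Q) := by
  have hbot : (LinearMap.range (T + Q))ᗮ = ⊥ := by
    rw [Submodule.eq_bot_iff]
    intro v hv
    obtain ⟨y, hy, hyv⟩ := mem_closure_iff_seq_limit.1 (hT v)
    choose x hx using hy
    have hTx : Tendsto (fun n => T (x n)) atTop (𝓝 v) := by simpa only [hx] using hyv
    refine hlim x v hTx ?_
    have hle : ∀ n, ‖Q (x n) - -v‖ ≤ ‖T (x n) - v‖ := by
      intro n
      have horth : inner 𝕜 ((T + Q) (x n)) v = 0 :=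
        (Submodule.mem_orthogonal _ v).1 hv _ ⟨x n, rfl⟩
      rw [LinearMap.add_apply, inner_add_left] at horth
      have hre := congrArg RCLike.re horth
      rw [map_add, map_zero] at hre
      have hsq : ‖Q (x n)‖ ^ 2 ≤ ‖T (x n)‖ ^ 2 := by gcongr; exact hQT _
      rw [sub_neg_eq_add]
      refine le_of_sq_le_sq ?_ (norm_nonneg _)
      rw [@norm_add_sq 𝕜, @norm_sub_sq 𝕜]
      linarith
    rw [tendsto_iff_norm_sub_tendsto_zero] at hTx ⊢
    exact squeeze_zero (fun _ => norm_nonneg _) hle hTx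
  have hdense := Submodule.topologicalClosure_eq_top_iff.2 hbot
  rw [← Submodule.dense_iff_topologicalClosure_eq_top] at hdense
  rwa [LinearMap.coe_range] at hdense

theorem LinearPMap.IsClosable.eq_zero_of_tendsto_s8 {𝕜 E F : Type*} [RCLike 𝕜]
    [NormedAddCommGroup E] [NormedSpace 𝕜 E] [NormedAddCommGroup F] [NormedSpace 𝕜 F]
    {f : E →ₗ.[𝕜] F} (hf : f.IsClosable) {x : ℕ → f.domain} {y : F}
    (hx : Tendsto (fun n => (x n : E)) atTop (𝓝 0))
    (hy : Tendsto (fun n => f (x n)) atTop (𝓝 y)) : y = 0 := by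
  obtain ⟨g, hg⟩ := hf
  have hmem : ((0 : E), y) ∈ f.graph.topologicalClosure :=
    mem_closure_of_tendsto (hx.prodMk_nhds hy) (Eventually.of_forall fun n => f.mem_graph (x n))
  rw [hg] at hmem
  exact g.graph_fst_eq_zero_snd hmem rfl

theorem cauchySeq_of_norm_le {𝕜 X E F : Type*} [RCLike 𝕜] [AddCommGroup X] [Module 𝕜 X]
    [NormedAddCommGroup E] [NormedSpace 𝕜 E] [NormedAddCommGroup F] [NormedSpace 𝕜 F]
    (P : X →ₗ[𝕜] F) (T : X →ₗ[𝕜] E) (hPT : ∀ x, ‖P x‖ ≤ ‖T x‖) {x : ℕ → X}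
    (hx : CauchySeq fun n => T (x n)) : CauchySeq fun n => P (x n) := by
  rw [Metric.cauchySeq_iff] at hx ⊢
  intro ε hε
  obtain ⟨N, hN⟩ := hx ε hε
  refine ⟨N, fun m hm n hn => lt_of_le_of_lt ?_ (hN m hm n hn)⟩
  rw [dist_eq_norm, dist_eq_norm, ← map_sub, ← map_sub]
  exact hPT _

/-- The operator `(h, k) ↦ (k + A h, h - B k)`. -/
noncomputable def LinearPMap.crossMap {𝕜 H K : Type*} [RCLike 𝕜]
    [NormedAddCommGroup H] [InnerProductSpace 𝕜 H] [NormedAddCommGroup K] [InnerProductSpace 𝕜 K]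
    (A : H →ₗ.[𝕜] K) (B : K →ₗ.[𝕜] H) : A.domain × B.domain →ₗ[𝕜] WithLp 2 (K × H) :=
  (WithLp.linearEquiv 2 𝕜 (K × H)).symm.toLinearMap ∘ₗ
    LinearMap.prod
      (B.domain.subtype ∘ₗ LinearMap.snd 𝕜 _ _ + A.toFun ∘ₗ LinearMap.fst 𝕜 _ _)
      (A.domain.subtype ∘ₗ LinearMap.fst 𝕜 _ _ - B.toFun ∘ₗ LinearMap.snd 𝕜 _ _)

/-- The operator `(h, k) ↦ (R h, - S k)` on `dom A × dom B`. -/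
noncomputable def LinearPMap.crossPerturbation {𝕜 H K : Type*} [RCLike 𝕜]
    [NormedAddCommGroup H] [InnerProductSpace 𝕜 H] [NormedAddCommGroup K] [InnerProductSpace 𝕜 K]
    {A R : H →ₗ.[𝕜] K} {B S : K →ₗ.[𝕜] H} (hAR : A.domain ≤ R.domain) (hBS : B.domain ≤ S.domain) :
    A.domain × B.domain →ₗ[𝕜] WithLp 2 (K × H) :=
  (WithLp.linearEquiv 2 𝕜 (K × H)).symm.toLinearMap ∘ₗ
    LinearMap.prodMap (R.toFun ∘ₗ Submodule.inclusion hAR) (-(S.toFun ∘ₗ Submodule.inclusion hBS))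

theorem LinearPMap.norm_crossMap_sq {𝕜 H K : Type*} [RCLike 𝕜]
    [NormedAddCommGroup H] [InnerProductSpace 𝕜 H] [NormedAddCommGroup K] [InnerProductSpace 𝕜 K]
    {A : H →ₗ.[𝕜] K} {B : K →ₗ.[𝕜] H}
    (hAB : ∀ (h : A.domain) (k : B.domain), inner 𝕜 (A h) (k : K) = inner 𝕜 (h : H) (B k))
    (x : A.domain × B.domain) :
    ‖A.crossMap B x‖ ^ 2 =
      ‖A x.1‖ ^ 2 + ‖(x.1 : H)‖ ^ 2 + (‖B x.2‖ ^ 2 + ‖(x.2 : K)‖ ^ 2) := by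
  rw [WithLp.prod_norm_sq_eq_of_L2]
  change ‖(x.2 : K) + A x.1‖ ^ 2 + ‖(x.1 : H) - B x.2‖ ^ 2 = _
  rw [add_comm (x.2 : K), @norm_add_sq 𝕜, @norm_sub_sq 𝕜, hAB]
  ring

theorem WithLp.denseRange_ofLp_comp_iff {𝕜 H K ι : Type*} [RCLike 𝕜]
    [NormedAddCommGroup H] [InnerProductSpace 𝕜 H] [NormedAddCommGroup K] [InnerProductSpace 𝕜 K]
    (f : ι → WithLp 2 (K × H)) :
    DenseRange (fun i => WithLp.ofLp (f i)) ↔ DenseRange f := by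
  let e := WithLp.prodContinuousLinearEquiv 2 𝕜 K H
  refine ⟨fun h => ?_, fun h => e.surjective.denseRange.comp h e.continuous⟩
  exact e.symm.surjective.denseRange.comp h e.symm.continuous

theorem LinearPMap.norm_crossPerturbation_le {𝕜 H K : Type*} [RCLike 𝕜]
    [NormedAddCommGroup H] [InnerProductSpace 𝕜 H] [NormedAddCommGroup K] [InnerProductSpace 𝕜 K]
    {A R : H →ₗ.[𝕜] K} {B S : K →ₗ.[𝕜] H} (hAR : A.domain ≤ R.domain) (hBS : B.domain ≤ S.domain)
    (hAB : ∀ (h : A.domain) (k : B.domain), inner 𝕜 (A h) (k : K) = inner 𝕜 (h : H) (B k))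
    (hR : ∀ h : A.domain, ‖R (Submodule.inclusion hAR h)‖ ^ 2 ≤ ‖A h‖ ^ 2 + ‖(h : H)‖ ^ 2)
    (hS : ∀ k : B.domain, ‖S (Submodule.inclusion hBS k)‖ ^ 2 ≤ ‖B k‖ ^ 2 + ‖(k : K)‖ ^ 2)
    (x : A.domain × B.domain) :
    ‖LinearPMap.crossPerturbation hAR hBS x‖ ≤ ‖A.crossMap B x‖ := by
  refine le_of_sq_le_sq ?_ (norm_nonneg _)
  rw [LinearPMap.norm_crossMap_sq hAB, WithLp.prod_norm_sq_eq_of_L2]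
  change ‖R (Submodule.inclusion hAR x.1)‖ ^ 2 + ‖-S (Submodule.inclusion hBS x.2)‖ ^ 2 ≤ _
  rw [norm_neg]
  exact add_le_add (hR x.1) (hS x.2)

theorem LinearPMap.eq_zero_of_tendsto_crossMap {𝕜 H K : Type*} [RCLike 𝕜]
    [NormedAddCommGroup H] [InnerProductSpace 𝕜 H] [CompleteSpace H]
    [NormedAddCommGroup K] [InnerProductSpace 𝕜 K] [CompleteSpace K]
    {A R : H →ₗ.[𝕜] K} {B S : K →ₗ.[𝕜] H} (hAR : A.domain ≤ R.domain) (hBS : B.domain ≤ S.domain)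
    (hAB : ∀ (h : A.domain) (k : B.domain), inner 𝕜 (A h) (k : K) = inner 𝕜 (h : H) (B k))
    (hRS : ∀ (h : R.domain) (k : S.domain), inner 𝕜 (R h) (k : K) = inner 𝕜 (h : H) (S k))
    (hA : A.IsClosable) (hB : B.IsClosable) {x : ℕ → A.domain × B.domain} {v : WithLp 2 (K × H)}
    (hT : Tendsto (fun n => A.crossMap B (x n)) atTop (𝓝 v))
    (hQ : Tendsto (fun n => LinearPMap.crossPerturbation hAR hBS (x n)) atTop (𝓝 (-v))) :
    v = 0 := by
  have hfst : Continuous fun z : WithLp 2 (K × H) => z.fst := by fun_prop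
  have hsnd : Continuous fun z : WithLp 2 (K × H) => z.snd := by fun_prop
  have hT₁ : Tendsto (fun n => ((x n).2 : K) + A (x n).1) atTop (𝓝 v.fst) :=
    (hfst.tendsto v).comp hT
  have hT₂ : Tendsto (fun n => ((x n).1 : H) - B (x n).2) atTop (𝓝 v.snd) :=
    (hsnd.tendsto v).comp hT
  have hR : Tendsto (fun n => R (Submodule.inclusion hAR (x n).1)) atTop (𝓝 (-v.fst)) :=
    (hfst.tendsto (-v)).comp hQ
  have hS : Tendsto (fun n => S (Submodule.inclusion hBS (x n).2)) atTop (𝓝 v.snd) := by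
    have hneg : Tendsto (fun n => -S (Submodule.inclusion hBS (x n).2)) atTop (𝓝 (-v.snd)) :=
      (hsnd.tendsto (-v)).comp hQ
    simpa using hneg.neg
  have hnorm := LinearPMap.norm_crossMap_sq hAB
  obtain ⟨h, hh⟩ : ∃ h : H, Tendsto (fun n => ((x n).1 : H)) atTop (𝓝 h) := by
    refine cauchySeq_tendsto_of_complete (cauchySeq_of_norm_le
      (A.domain.subtype ∘ₗ LinearMap.fst 𝕜 A.domain B.domain) (A.crossMap B) (fun y => ?_) hT.cauchySeq)
    refine le_of_sq_le_sq ?_ (norm_nonneg _)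
    rw [hnorm]
    change ‖(y.1 : H)‖ ^ 2 ≤ _
    nlinarith [sq_nonneg ‖A y.1‖, sq_nonneg ‖B y.2‖, sq_nonneg ‖(y.2 : K)‖]
  obtain ⟨k, hk⟩ : ∃ k : K, Tendsto (fun n => ((x n).2 : K)) atTop (𝓝 k) := by
    refine cauchySeq_tendsto_of_complete (cauchySeq_of_norm_le
      (B.domain.subtype ∘ₗ LinearMap.snd 𝕜 A.domain B.domain) (A.crossMap B) (fun y => ?_) hT.cauchySeq)
    refine le_of_sq_le_sq ?_ (norm_nonneg _)
    rw [hnorm]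
    change ‖(y.2 : K)‖ ^ 2 ≤ _
    nlinarith [sq_nonneg ‖A y.1‖, sq_nonneg ‖B y.2‖, sq_nonneg ‖(y.1 : H)‖]
  have hAlim : Tendsto (fun n => A (x n).1) atTop (𝓝 (v.fst - k)) := by
    simpa using hT₁.sub hk
  have hBlim : Tendsto (fun n => B (x n).2) atTop (𝓝 (h - v.snd)) := by
    simpa using hh.sub hT₂
  have hABlim : inner 𝕜 (v.fst - k) k = inner 𝕜 h (h - v.snd) :=
    tendsto_nhds_unique (hAlim.inner hk)
      ((hh.inner hBlim).congr fun n => (hAB (x n).1 (x n).2).symm)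
  have hRSlim : inner 𝕜 (-v.fst) k = inner 𝕜 h v.snd :=
    tendsto_nhds_unique (hR.inner hk) ((hh.inner hS).congr fun n =>
      (hRS (Submodule.inclusion hAR (x n).1) (Submodule.inclusion hBS (x n).2)).symm)
  have hsum : ‖h‖ ^ 2 + ‖k‖ ^ 2 = 0 := by
    rw [inner_sub_left, inner_sub_right] at hABlim
    rw [inner_neg_left] at hRSlim
    rw [@norm_sq_eq_re_inner 𝕜, @norm_sq_eq_re_inner 𝕜 _ _ _ _ k, ← _root_.map_add]
    have hz : inner 𝕜 h h + inner 𝕜 k k = (0 : 𝕜) := by linear_combination -hABlim - hRSlim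
    rw [hz, _root_.map_zero]
  have h0 : h = 0 := norm_eq_zero.1 (by nlinarith [sq_nonneg ‖h‖, sq_nonneg ‖k‖])
  have k0 : k = 0 := norm_eq_zero.1 (by nlinarith [sq_nonneg ‖h‖, sq_nonneg ‖k‖])
  subst h0 k0
  have hv₁ := hA.eq_zero_of_tendsto_s8 hh hAlim
  have hv₂ := hB.eq_zero_of_tendsto_s8 hk hBlim
  rw [sub_zero] at hv₁
  rw [zero_sub, neg_eq_zero] at hv₂
  exact WithLp.ofLp_injective 2 (Prod.ext hv₁ hv₂)

end CrossMap

variable {𝕜 H K : Type*} [RCLike 𝕜]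
  [NormedAddCommGroup H] [InnerProductSpace 𝕜 H] [CompleteSpace H]
  [NormedAddCommGroup K] [InnerProductSpace 𝕜 K] [CompleteSpace K]

local notation "⟪" x ", " y "⟫" => @inner 𝕜 _ _ x y

theorem sum_closable_stmt8
    (A R : H →ₗ.[𝕜] K) (B S : K →ₗ.[𝕜] H)
    (hAR : A.domain ≤ R.domain) (hBS : B.domain ≤ S.domain)
    (hAB : ∀ (h : A.domain) (k : B.domain), ⟪A h, (k : K)⟫ = ⟪(h : H), B k⟫)
    (hRS : ∀ (h : R.domain) (k : S.domain), ⟪R h, (k : K)⟫ = ⟪(h : H), S k⟫)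
    (haA : A.IsClosable) (haB : B.IsClosable)
    (hb : Dense {z : K × H | ∃ (h : A.domain) (k : B.domain),
      ((k : K) + A h, (h : H) - B k) = z})
    (hc : ∀ h : A.domain, ‖R (Submodule.inclusion hAR h)‖ ^ 2 ≤ ‖A h‖ ^ 2 + ‖(h : H)‖ ^ 2)
    (hd : ∀ k : B.domain, ‖S (Submodule.inclusion hBS k)‖ ^ 2 ≤ ‖B k‖ ^ 2 + ‖(k : K)‖ ^ 2) :
    Dense {z : K × H | ∃ (h : A.domain) (k : B.domain),
      ((k : K) + (A h + R (Submodule.inclusion hAR h)),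
        (h : H) - (B k + S (Submodule.inclusion hBS k))) = z} := by
  have hT : DenseRange (A.crossMap B) := by
    rw [← WithLp.denseRange_ofLp_comp_iff (𝕜 := 𝕜)]
    refine hb.mono ?_
    rintro _ ⟨h, k, rfl⟩
    exact ⟨(h, k), rfl⟩
  have hTQ := denseRange_add_of_norm_le (A.crossMap B) (LinearPMap.crossPerturbation hAR hBS) hT
    (LinearPMap.norm_crossPerturbation_le hAR hBS hAB hc hd)
    fun _ _ => LinearPMap.eq_zero_of_tendsto_crossMap hAR hBS hAB hRS haA haB
  rw [← WithLp.denseRange_ofLp_comp_iff (𝕜 := 𝕜)] at hTQ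
  refine hTQ.mono ?_
  rintro _ ⟨⟨h, k⟩, rfl⟩
  refine ⟨h, k, Prod.ext ?_ ?_⟩
  · change (k : K) + (A h + R _) = (k : K) + A h + R _
    abel
  · change (h : H) - (B k + S _) = (h : H) - B k + -S _
    abel
end

section
/- Let R be a linear operator from a Hilbert space H to a Hilbert space K, and B, S linear operators from K to H, satisfying: (a) dom B* ⊆ dom R and dom B ⊆ dom S; (b) B is densely defined and closable; (c) B* + R (with domain dom B*) is closed; (d) ⟨Rh, k⟩ = ⟨h, Sk⟩ for all h ∈ dom B*, k ∈ dom B; (e) ‖Rh‖² ≤ ‖B*h‖² + ‖h‖² for all h ∈ dom B*; (f) ‖Sk‖² ≤ ‖Bk‖² + ‖k‖² for all k ∈ dom B. Then B + S (with domain dom B) is densely defined and closable, and its adjoint satisfies (B + S)* = B* + R. -/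
/- STATEMENT 9: Theorem 12 of the paper (generalized Hess–Kato). -/

variable {𝕜 H K : Type*} [RCLike 𝕜]
  [NormedAddCommGroup H] [InnerProductSpace 𝕜 H] [CompleteSpace H]
  [NormedAddCommGroup K] [InnerProductSpace 𝕜 K] [CompleteSpace K]

local notation "⟪" x ", " y "⟫" => @inner 𝕜 _ _ x y

/-- The sum of two partially defined operators, restricted to the domain of the first
one (which is assumed to be contained in the domain of the second one). -/
def LinearPMap.sumRestrict {R E F : Type*} [Ring R] [AddCommGroup E] [Module R E]
    [AddCommGroup F] [Module R F] (B S : E →ₗ.[R] F) (h : B.domain ≤ S.domain) :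
    E →ₗ.[R] F where
  domain := B.domain
  toFun := B.toFun + S.toFun.comp (Submodule.inclusion h)

section DenseRange

variable {V X : Type*} [AddCommGroup V] [Module 𝕜 V] [NormedAddCommGroup X] [InnerProductSpace 𝕜 X]

theorem LinearMap.denseRange_of_inner_eq_zero [CompleteSpace X] (f : V →ₗ[𝕜] X)
    (h : ∀ w, (∀ x, ⟪w, f x⟫ = 0) → w = 0) : DenseRange f := by
  have : (LinearMap.range f).topologicalClosure = ⊤ := by
    rw [Submodule.topologicalClosure_eq_top_iff, Submodule.eq_bot_iff]
    intro w hw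
    refine h w fun x => ?_
    exact (Submodule.mem_orthogonal' _ _).1 hw _ (LinearMap.mem_range_self f x)
  have h2 := Submodule.dense_iff_topologicalClosure_eq_top.2 this
  rwa [LinearMap.coe_range] at h2

theorem norm_inner_self (x : X) : ‖⟪x, x⟫‖ = ‖x‖ ^ 2 := by
  rw [inner_self_eq_norm_sq_to_K, norm_pow, RCLike.norm_ofReal, abs_norm]

theorem DenseRange.exists_norm_sub_le {ι : Type*} {f : ι → X} (hf : DenseRange f) (w : X)
    {ε : ℝ} (hε : 0 < ε) : ∃ x, ‖w - f x‖ ≤ ε := by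
  obtain ⟨x, hx⟩ := hf.exists_dist_lt w hε
  exact ⟨x, by rw [← dist_eq_norm]; exact hx.le⟩

theorem norm_add_sq_of_re_inner_eq_zero {x y : X} (h : RCLike.re ⟪y, x⟫ = 0) :
    ‖x + y‖ ^ 2 = ‖x‖ ^ 2 + ‖y‖ ^ 2 := by
  rw [norm_add_sq (𝕜 := 𝕜), inner_re_symm, h]
  ring

variable {J A P : V →ₗ[𝕜] X}

theorem re_inner_self_eq_zero_of_skew (hP : ∀ x y, ⟪P x, J y⟫ = -⟪J x, P y⟫) (x : V) :
    RCLike.re ⟪P x, J x⟫ = 0 := by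
  have h := congrArg RCLike.re (hP x x)
  rw [map_neg, inner_re_symm (J x)] at h
  linarith

/-- Kato–Rellich for skew-symmetric operators with relative bound `t < 1`. -/
theorem denseRange_add_smul_of_skew [CompleteSpace X]
    (hA : ∀ x, RCLike.re ⟪A x, J x⟫ = 0) (hJA : DenseRange (J + A))
    (hPA : ∀ x, ‖P x‖ ^ 2 ≤ ‖A x‖ ^ 2 + ‖J x‖ ^ 2) {t : ℝ} (ht₀ : 0 ≤ t) (ht₁ : t < 1) :
    DenseRange (J + A + (t : 𝕜) • P) := by
  refine LinearMap.denseRange_of_inner_eq_zero _ fun w hw => ?_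
  have key : ∀ ε > 0, ‖w‖ ^ 2 ≤ t * ‖w‖ ^ 2 + ε * (2 * ‖w‖) := by
    intro ε hε
    obtain ⟨x, hx⟩ := hJA.exists_norm_sub_le w hε
    rw [LinearMap.add_apply] at hx
    have hP : ‖P x‖ ≤ ‖J x + A x‖ := by
      refine le_of_sq_le_sq ?_ (norm_nonneg _)
      rw [norm_add_sq_of_re_inner_eq_zero (hA x)]
      linarith [hPA x]
    have hn : ‖J x + A x‖ ≤ ‖w‖ + ε := by
      have := norm_sub_norm_le (J x + A x) w
      rw [norm_sub_rev] at this
      linarith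
    have hz := hw x
    simp only [LinearMap.add_apply, LinearMap.smul_apply, inner_add_right w (J x + A x),
      inner_smul_right] at hz
    have hs : ⟪w, w⟫ = ⟪w, w - (J x + A x)⟫ - (t : 𝕜) * ⟪w, P x⟫ := by
      rw [inner_sub_right]
      linear_combination hz
    have h1 : ‖w‖ ^ 2 ≤ ‖w‖ * ε + t * (‖w‖ * (‖w‖ + ε)) := by
      rw [← norm_inner_self (𝕜 := 𝕜), hs]
      refine (norm_sub_le _ _).trans (add_le_add ?_ ?_)
      · exact (norm_inner_le_norm _ _).trans (by gcongr)
      · rw [norm_mul, RCLike.norm_ofReal, abs_of_nonneg ht₀]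
        gcongr
        exact (norm_inner_le_norm _ _).trans (by gcongr; exact hP.trans hn)
    nlinarith [mul_nonneg (mul_nonneg (sub_nonneg.2 ht₁.le) (norm_nonneg w)) hε.le]
  have : ‖w‖ ^ 2 ≤ t * ‖w‖ ^ 2 := by
    have hlim : Filter.Tendsto (fun ε : ℝ => t * ‖w‖ ^ 2 + ε * (2 * ‖w‖))
        (nhdsWithin 0 (Set.Ioi 0)) (nhds (t * ‖w‖ ^ 2 + 0 * (2 * ‖w‖))) :=
      (Continuous.tendsto (by fun_prop) _).mono_left nhdsWithin_le_nhds
    rw [zero_mul, add_zero] at hlim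
    exact ge_of_tendsto hlim (Filter.eventually_of_mem self_mem_nhdsWithin key)
  have h0 : ‖w‖ ^ 2 = 0 := by nlinarith [sq_nonneg ‖w‖]
  simpa using h0

/-- Wüst's theorem for skew-symmetric operators: relative bound one. -/
theorem denseRange_add_of_skew [CompleteSpace X] (hJ : DenseRange J)
    (hA : ∀ x, RCLike.re ⟪A x, J x⟫ = 0) (hP : ∀ x y, ⟪P x, J y⟫ = -⟪J x, P y⟫)
    (hJA : DenseRange (J + A)) (hPA : ∀ x, ‖P x‖ ^ 2 ≤ ‖A x‖ ^ 2 + ‖J x‖ ^ 2) :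
    DenseRange (J + A + P) := by
  refine LinearMap.denseRange_of_inner_eq_zero _ fun w hw => ?_
  set C : ℝ := ‖w‖ + 1 with hC
  have hw0 := norm_nonneg w
  have key : ∀ y, ∀ δ ∈ Set.Ioc (0 : ℝ) 1,
      ‖w‖ ^ 2 ≤ 3 * C * ‖w - J y‖ + δ * (C * ‖P y‖ + ‖w‖) := by
    rintro y δ ⟨hδ₀, hδ₁⟩
    obtain ⟨x, hx⟩ := (denseRange_add_smul_of_skew (t := 1 - δ) hA hJA hPA
      (by linarith) (by linarith)).exists_norm_sub_le w hδ₀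
    simp only [LinearMap.add_apply, LinearMap.smul_apply, add_assoc] at hx
    set Q : X := A x + ((1 - δ : ℝ) : 𝕜) • P x with hQ
    have hn : ‖J x + Q‖ ≤ C := by
      have := norm_sub_norm_le (J x + Q) w
      rw [norm_sub_rev] at this
      linarith
    have hQJ : RCLike.re ⟪Q, J x⟫ = 0 := by
      rw [hQ, inner_add_left, inner_smul_left, RCLike.conj_ofReal, map_add, RCLike.re_ofReal_mul,
        hA, re_inner_self_eq_zero_of_skew hP]
      ring
    have hsq := norm_add_sq_of_re_inner_eq_zero hQJ
    have hJx : ‖J x‖ ≤ C := by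
      refine le_trans (le_of_sq_le_sq ?_ (norm_nonneg _)) hn
      nlinarith [sq_nonneg ‖Q‖]
    have hQx : ‖Q‖ ≤ C := by
      refine le_trans (le_of_sq_le_sq ?_ (norm_nonneg _)) hn
      nlinarith [sq_nonneg ‖J x‖]
    have hPx : ‖P x‖ ≤ ‖A x‖ + ‖J x‖ := by
      refine le_of_sq_le_sq ?_ (by positivity)
      nlinarith [hPA x, mul_nonneg (norm_nonneg (A x)) (norm_nonneg (J x))]
    have hAx : ‖A x‖ ≤ ‖Q‖ + (1 - δ) * ‖P x‖ := by
      have : A x = Q - ((1 - δ : ℝ) : 𝕜) • P x := by rw [hQ]; abel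
      rw [this]
      refine (norm_sub_le _ _).trans_eq ?_
      rw [norm_smul, RCLike.norm_ofReal, abs_of_nonneg (by linarith : 0 ≤ 1 - δ)]
    have hδP : δ * ‖P x‖ ≤ 3 * C := by
      nlinarith [norm_nonneg (P x)]
    have hz := hw x
    have hs : ⟪w, w⟫ = ⟪w, w - (J x + Q)⟫ - (δ : 𝕜) * (⟪w - J y, P x⟫ + ⟪J y, P x⟫) := by
      simp only [LinearMap.add_apply, inner_add_right] at hz
      simp only [hQ, inner_sub_right, inner_sub_left, inner_add_right, inner_smul_right]
      push_cast
      linear_combination hz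
    have hskew : ‖⟪J y, P x⟫‖ ≤ C * ‖P y‖ := by
      have : ⟪J y, P x⟫ = -⟪P y, J x⟫ := by rw [hP, neg_neg]
      rw [this, norm_neg, mul_comm]
      exact (norm_inner_le_norm _ _).trans (by gcongr)
    rw [← norm_inner_self (𝕜 := 𝕜), hs]
    have h1 : ‖⟪w, w - (J x + Q)⟫‖ ≤ ‖w‖ * δ :=
      (norm_inner_le_norm _ _).trans (by gcongr)
    have h2 : ‖(δ : 𝕜) * (⟪w - J y, P x⟫ + ⟪J y, P x⟫)‖ ≤
        δ * (‖w - J y‖ * ‖P x‖ + C * ‖P y‖) := by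
      rw [norm_mul, RCLike.norm_ofReal, abs_of_pos hδ₀]
      gcongr
      exact (norm_add_le _ _).trans (add_le_add (norm_inner_le_norm _ _) hskew)
    have h3 := mul_le_mul_of_nonneg_left hδP (norm_nonneg (w - J y))
    have h4 := norm_sub_le ⟪w, w - (J x + Q)⟫ ((δ : 𝕜) * (⟪w - J y, P x⟫ + ⟪J y, P x⟫))
    linarith
  have key' : ∀ y, ‖w‖ ^ 2 ≤ 3 * C * ‖w - J y‖ := by
    intro y
    have hlim : Filter.Tendsto (fun δ : ℝ => 3 * C * ‖w - J y‖ + δ * (C * ‖P y‖ + ‖w‖))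
        (nhdsWithin 0 (Set.Ioi 0)) (nhds (3 * C * ‖w - J y‖ + 0 * (C * ‖P y‖ + ‖w‖))) :=
      (Continuous.tendsto (by fun_prop) _).mono_left nhdsWithin_le_nhds
    rw [zero_mul, add_zero] at hlim
    exact ge_of_tendsto hlim (Filter.eventually_of_mem (Ioc_mem_nhdsGT one_pos) (key y))
  have h0 : ‖w‖ ^ 2 ≤ 0 := by
    refine le_of_forall_pos_le_add fun ε hε => ?_
    have hC0 : 0 < 3 * C := by positivity
    obtain ⟨y, hy⟩ := hJ.exists_norm_sub_le w (div_pos hε hC0)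
    calc ‖w‖ ^ 2 ≤ 3 * C * ‖w - J y‖ := key' y
      _ ≤ 3 * C * (ε / (3 * C)) := by gcongr
      _ = 0 + ε := by rw [zero_add, mul_div_cancel₀ _ hC0.ne']
  simpa using le_antisymm h0 (sq_nonneg _)

end DenseRange

namespace LinearPMap

theorem adjoint_domain_dense_of_isClosable {B : K →ₗ.[𝕜] H} (hB : B.IsClosable) :
    Dense (B.adjoint.domain : Set H) := by
  rw [Submodule.dense_iff_topologicalClosure_eq_top, Submodule.topologicalClosure_eq_top_iff,
    Submodule.eq_bot_iff]
  intro h hh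
  obtain ⟨B', hB'⟩ := hB
  have hmem : ((0, h) : K × H) ∈ B.graph.topologicalClosure := by
    let e := (WithLp.linearEquiv 2 𝕜 (K × H)).symm
    have h1 : e (0, h) ∈ (B.graph.map e.toLinearMap)ᗮᗮ := by
      rw [Submodule.mem_orthogonal]
      intro v hv
      rw [Submodule.mem_orthogonal] at hv
      have hvB : v.snd ∈ B.adjoint.domain := by
        refine mem_adjoint_domain_of_exists _ ⟨-v.fst, fun k => ?_⟩
        have h2 := hv _ (Submodule.mem_map_of_mem (B.mem_graph k))
        rw [WithLp.prod_inner_apply] at h2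
        have h3 : ⟪(k : K), v.fst⟫ + ⟪B k, v.snd⟫ = 0 := h2
        have h4 := congrArg (starRingEnd 𝕜) h3
        rw [RingHom.map_add, inner_conj_symm, inner_conj_symm, RingHom.map_zero] at h4
        rw [inner_neg_left]
        linear_combination -h4
      rw [WithLp.prod_inner_apply]
      have h5 : ⟪v.fst, (0 : K)⟫ + ⟪v.snd, h⟫ = 0 := by
        rw [inner_zero_right, zero_add]
        exact (Submodule.mem_orthogonal _ _).1 hh _ hvB
      exact h5
    rw [Submodule.orthogonal_orthogonal_eq_closure] at h1
    refine map_mem_closure (f := WithLp.ofLp) (WithLp.prod_continuous_ofLp 2 K H) h1 ?_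
    rintro _ ⟨p, hp, rfl⟩
    exact hp
  rw [hB'] at hmem
  exact B'.graph_fst_eq_zero_snd hmem rfl

theorem isClosable_of_adjoint_domain_dense {T : K →ₗ.[𝕜] H} (hT : Dense (T.domain : Set K))
    (hT' : Dense (T.adjoint.domain : Set H)) : T.IsClosable :=
  (adjoint_isClosed hT').isClosable.leIsClosable
    (IsFormalAdjoint.le_adjoint hT' (adjoint_isFormalAdjoint hT))

end LinearPMap

section SkewMap

variable {E F : Type*} [NormedAddCommGroup E] [InnerProductSpace 𝕜 E]
  [NormedAddCommGroup F] [InnerProductSpace 𝕜 F]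

variable {D' D : Type*} [AddCommGroup D'] [Module 𝕜 D'] [AddCommGroup D] [Module 𝕜 D]

/-- The skew operator matrix whose off-diagonal entries are the second map and minus the first. -/
noncomputable def skewMap (T' : D' →ₗ[𝕜] F) (T : D →ₗ[𝕜] E) :
    D' × D →ₗ[𝕜] WithLp 2 (E × F) :=
  (WithLp.linearEquiv 2 𝕜 (E × F)).symm.toLinearMap ∘ₗ
    (T ∘ₗ LinearMap.snd 𝕜 D' D).prod (-(T' ∘ₗ LinearMap.fst 𝕜 D' D))

/-- The inclusion of a product of submodules into the Hilbert sum. -/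
noncomputable def prodInclusion (D' : Submodule 𝕜 E) (D : Submodule 𝕜 F) :
    D' × D →ₗ[𝕜] WithLp 2 (E × F) :=
  (WithLp.linearEquiv 2 𝕜 (E × F)).symm.toLinearMap ∘ₗ D'.subtype.prodMap D.subtype

theorem skewMap_apply (T' : D' →ₗ[𝕜] F) (T : D →ₗ[𝕜] E) (x : D' × D) :
    skewMap T' T x = WithLp.toLp 2 (T x.2, -T' x.1) :=
  rfl

theorem skewMap_add (T' R' : D' →ₗ[𝕜] F) (T R : D →ₗ[𝕜] E) :
    skewMap (T' + R') (T + R) = skewMap T' T + skewMap R' R := by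
  refine LinearMap.ext fun x => ?_
  simp [skewMap_apply, ← WithLp.toLp_add, add_comm]

theorem prodInclusion_apply (D' : Submodule 𝕜 E) (D : Submodule 𝕜 F) (x : D' × D) :
    prodInclusion D' D x = WithLp.toLp 2 ((x.1 : E), (x.2 : F)) :=
  rfl

theorem norm_skewMap_sq (T' : D' →ₗ[𝕜] F) (T : D →ₗ[𝕜] E) (x : D' × D) :
    ‖skewMap T' T x‖ ^ 2 = ‖T x.2‖ ^ 2 + ‖T' x.1‖ ^ 2 := by
  rw [WithLp.prod_norm_sq_eq_of_L2, skewMap_apply]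
  simp

theorem norm_prodInclusion_sq (D' : Submodule 𝕜 E) (D : Submodule 𝕜 F) (x : D' × D) :
    ‖prodInclusion D' D x‖ ^ 2 = ‖(x.1 : E)‖ ^ 2 + ‖(x.2 : F)‖ ^ 2 := by
  rw [WithLp.prod_norm_sq_eq_of_L2, prodInclusion_apply]
  rfl

theorem inner_skewMap_prodInclusion {D' : Submodule 𝕜 E} {D : Submodule 𝕜 F}
    {T' : D' →ₗ[𝕜] F} {T : D →ₗ[𝕜] E} (hT : ∀ (h : D') (k : D), ⟪T' h, (k : F)⟫ = ⟪(h : E), T k⟫)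
    (x y : D' × D) :
    ⟪skewMap T' T x, prodInclusion D' D y⟫ = -⟪prodInclusion D' D x, skewMap T' T y⟫ := by
  have h1 : ⟪(x.2 : F), T' y.1⟫ = ⟪T x.2, (y.1 : E)⟫ := by
    rw [← inner_conj_symm, hT, inner_conj_symm]
  simp only [WithLp.prod_inner_apply, skewMap_apply, prodInclusion_apply, inner_neg_left,
    inner_neg_right, hT, h1]
  ring

theorem denseRange_prodInclusion {D' : Submodule 𝕜 E} {D : Submodule 𝕜 F}
    (hD' : Dense (D' : Set E)) (hD : Dense (D : Set F)) : DenseRange (prodInclusion D' D) :=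
  (WithLp.homeomorphProd 2 E F).symm.surjective.denseRange.comp
    (hD'.denseRange_val.prodMap hD.denseRange_val) (WithLp.homeomorphProd 2 E F).symm.continuous

theorem LinearPMap.denseRange_prodInclusion_add_skewMap [CompleteSpace E] [CompleteSpace F]
    {B : F →ₗ.[𝕜] E}
    (hB : Dense (B.domain : Set F)) :
    DenseRange (prodInclusion B.adjoint.domain B.domain + skewMap B.adjoint.toFun B.toFun) := by
  refine LinearMap.denseRange_of_inner_eq_zero _ fun w hw => ?_
  have hk : ∀ k : B.domain, ⟪-w.snd, (k : F)⟫ = ⟪w.fst, B k⟫ := fun k => by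
    have h1 := hw (0, k)
    rw [WithLp.prod_inner_apply] at h1
    have h2 : ⟪w.fst, 0 + B k⟫ + ⟪w.snd, (k : F) + -B.adjoint 0⟫ = 0 := h1
    rw [B.adjoint.map_zero, neg_zero, add_zero, zero_add] at h2
    rw [inner_neg_left]
    exact (eq_neg_of_add_eq_zero_left h2).symm
  have hu : w.fst ∈ B.adjoint.domain := mem_adjoint_domain_of_exists _ ⟨_, hk⟩
  have hBu : B.adjoint ⟨w.fst, hu⟩ = -w.snd := adjoint_apply_eq hB _ hk
  have h2 := hw (⟨w.fst, hu⟩, 0)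
  have h3 : ⟪w.fst, w.fst + B 0⟫ + ⟪w.snd, 0 + -B.adjoint ⟨w.fst, hu⟩⟫ = 0 := by
    rw [WithLp.prod_inner_apply] at h2
    exact h2
  rw [hBu, neg_neg, zero_add, B.map_zero, add_zero] at h3
  have h4 : ⟪w, w⟫ = 0 := by
    rw [WithLp.prod_inner_apply]
    exact h3
  exact inner_self_eq_zero.1 h4

/-- A closed formal adjoint is the adjoint as soon as the associated skew-symmetric operator
matrix is essentially skew-adjoint. -/
theorem LinearPMap.adjoint_eq_of_denseRange [CompleteSpace F] {T : F →ₗ.[𝕜] E}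
    {T' : E →ₗ.[𝕜] F}
    (hT : Dense (T.domain : Set F)) (hT' : T'.IsClosed) (hTT' : T.IsFormalAdjoint T')
    (hd : DenseRange (prodInclusion T'.domain T.domain + skewMap T'.toFun T.toFun)) :
    T.adjoint = T' := by
  have hle : T' ≤ T.adjoint := hTT'.le_adjoint hT
  refine le_antisymm (le_of_le_graph ?_) hle
  rintro p hp
  obtain ⟨u, rfl⟩ := T.adjoint.mem_graph_iff'.1 hp
  have hT'c : _root_.IsClosed (T'.graph : Set (E × F)) := hT'
  rw [← SetLike.mem_coe, ← hT'c.closure_eq, Metric.mem_closure_iff]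
  intro ε hε
  obtain ⟨x, hx⟩ := hd.exists_dist_lt (WithLp.toLp 2 ((u : E), -T.adjoint u)) hε
  refine ⟨_, T'.mem_graph x.1, ?_⟩
  let y : T.adjoint.domain × T.domain := (u - Submodule.inclusion hle.1 x.1, -x.2)
  have hT'x : T.adjoint (Submodule.inclusion hle.1 x.1) = T' x.1 := (hle.2 rfl).symm
  have hy : WithLp.toLp 2 ((u : E), -T.adjoint u) -
      (prodInclusion T'.domain T.domain + skewMap T'.toFun T.toFun) x =
      prodInclusion T.adjoint.domain T.domain y + skewMap T.adjoint.toFun T.toFun y := by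
    refine WithLp.ofLp_injective 2 (Prod.ext ?_ ?_)
    · change (u : E) - (x.1 + T x.2) = (u - x.1) + T (-x.2)
      rw [T.map_neg]
      abel
    · change -T.adjoint u - (x.2 + -T' x.1) =
        -x.2 + -T.adjoint (u - Submodule.inclusion hle.1 x.1)
      rw [T.adjoint.map_sub, hT'x]
      abel
  have hskew := re_inner_self_eq_zero_of_skew
    (inner_skewMap_prodInclusion (T' := T.adjoint.toFun) (T := T.toFun)
      (adjoint_isFormalAdjoint hT)) y
  have hsq := norm_add_sq_of_re_inner_eq_zero hskew
  rw [← hy, norm_prodInclusion_sq, norm_skewMap_sq, ← dist_eq_norm] at hsq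
  have h1 : dist (u : E) x.1 = ‖(y.1 : E)‖ := dist_eq_norm _ _
  have h2 : dist (T.adjoint u) (T' x.1) = ‖T.adjoint.toFun y.1‖ := by
    rw [dist_eq_norm, ← hT'x, ← T.adjoint.map_sub]
    rfl
  rw [Prod.dist_eq, h1, h2]
  refine (max_le ?_ ?_).trans_lt hx <;> refine le_of_sq_le_sq ?_ dist_nonneg <;> rw [hsq]
  · nlinarith [sq_nonneg ‖(y.2 : F)‖, sq_nonneg ‖T.toFun y.2‖, sq_nonneg ‖T.adjoint.toFun y.1‖]
  · nlinarith [sq_nonneg ‖(y.2 : F)‖, sq_nonneg ‖T.toFun y.2‖, sq_nonneg ‖(y.1 : E)‖]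

end SkewMap

theorem sum_closable_stmt9
    (R : H →ₗ.[𝕜] K) (B S : K →ₗ.[𝕜] H)
    (ha₁ : B.adjoint.domain ≤ R.domain) (ha₂ : B.domain ≤ S.domain)
    (hb₁ : Dense (B.domain : Set K)) (hb₂ : B.IsClosable)
    (hc : (B.adjoint.sumRestrict R ha₁).IsClosed)
    (hd : ∀ (h : B.adjoint.domain) (k : B.domain),
      ⟪R (Submodule.inclusion ha₁ h), (k : K)⟫ =
        ⟪(h : H), S (Submodule.inclusion ha₂ k)⟫)
    (he : ∀ h : B.adjoint.domain,
      ‖R (Submodule.inclusion ha₁ h)‖ ^ 2 ≤ ‖B.adjoint h‖ ^ 2 + ‖(h : H)‖ ^ 2)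
    (hf : ∀ k : B.domain,
      ‖S (Submodule.inclusion ha₂ k)‖ ^ 2 ≤ ‖B k‖ ^ 2 + ‖(k : K)‖ ^ 2) :
    Dense ((B.sumRestrict S ha₂).domain : Set K) ∧ (B.sumRestrict S ha₂).IsClosable ∧
      (B.sumRestrict S ha₂).adjoint = B.adjoint.sumRestrict R ha₁ := by
  have hDense := LinearPMap.adjoint_domain_dense_of_isClosable hb₂
  have hformal := LinearPMap.adjoint_isFormalAdjoint hb₁
  have hadj : (B.sumRestrict S ha₂).adjoint = B.adjoint.sumRestrict R ha₁ := by
    refine LinearPMap.adjoint_eq_of_denseRange hb₁ hc ?_ ?_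
    · refine LinearPMap.IsFormalAdjoint.symm fun h k => ?_
      refine (inner_add_left _ _ _).trans (Eq.trans ?_ (inner_add_right _ _ _).symm)
      exact congrArg₂ _ (hformal h k) (hd h k)
    · have h := denseRange_add_of_skew
        (J := prodInclusion B.adjoint.domain B.domain)
        (A := skewMap B.adjoint.toFun B.toFun)
        (P := skewMap (R.toFun.comp (Submodule.inclusion ha₁))
          (S.toFun.comp (Submodule.inclusion ha₂)))
        (denseRange_prodInclusion hDense hb₁)
        (re_inner_self_eq_zero_of_skew (inner_skewMap_prodInclusion hformal))
        (inner_skewMap_prodInclusion hd)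
        (LinearPMap.denseRange_prodInclusion_add_skewMap hb₁)
        (fun x => by
          rw [norm_skewMap_sq, norm_skewMap_sq, norm_prodInclusion_sq]
          have h1 := add_le_add (he x.1) (hf x.2)
          calc _ = _ := add_comm _ _
            _ ≤ _ := h1
            _ = (‖B x.2‖ ^ 2 + ‖B.adjoint x.1‖ ^ 2) + (‖(x.1 : H)‖ ^ 2 + ‖(x.2 : K)‖ ^ 2) := by
              ring)
      rw [add_assoc, ← skewMap_add] at h
      exact h
  refine ⟨hb₁, LinearPMap.isClosable_of_adjoint_domain_dense hb₁ ?_, hadj⟩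
  rw [hadj]
  exact hDense
end

section
/- Let B and S be linear operators from a Hilbert space H to a Hilbert space K satisfying: (a) dom B ⊆ dom S and dom B* ⊆ dom S*; (b) B is densely defined and closable, and S is densely defined; (c) B* + S* (with domain dom B*) is closed; (d) ‖Sh‖² ≤ ‖Bh‖² + ‖h‖² for all h ∈ dom B; (e) ‖S*k‖² ≤ ‖B*k‖² + ‖k‖² for all k ∈ dom B*. Then B + S (with domain dom B) is densely defined and closable, and its adjoint satisfies (B + S)* = B* + S*. -/
/- STATEMENT 10: Corollary 14 of the paper. -/

variable {𝕜 H K : Type*} [RCLike 𝕜]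
  [NormedAddCommGroup H] [InnerProductSpace 𝕜 H] [CompleteSpace H]
  [NormedAddCommGroup K] [InnerProductSpace 𝕜 K] [CompleteSpace K]

open Filter Topology WithLp

theorem tendsto_add_of_norm_le_of_inner_eq_zero {𝕜 X D : Type*} [RCLike 𝕜]
    [NormedAddCommGroup X] [InnerProductSpace 𝕜 X] {M N : D → X} (hNM : ∀ x, ‖N x‖ ≤ ‖M x‖)
    {z : X} (hz : ∀ x, inner 𝕜 (M x + N x) z = 0) {l : Filter D} (hM : Tendsto M l (𝓝 z)) :
    Tendsto (fun x ↦ M x + N x) l (𝓝 0) := by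
  have hbound (x : D) : ‖M x + N x‖ ^ 2 ≤
      2 * ‖M x‖ ^ 2 - 2 * RCLike.re (inner 𝕜 (M x) z) + 2 * (‖M x‖ * ‖M x - z‖) := by
    have h₁ : ‖M x + N x‖ ^ 2 =
        ‖M x‖ ^ 2 + 2 * RCLike.re (inner 𝕜 (N x) (M x)) + ‖N x‖ ^ 2 := by
      rw [norm_add_sq (𝕜 := 𝕜), inner_re_symm]
    have h₂ : RCLike.re (inner 𝕜 (N x) (M x)) =
        RCLike.re (inner 𝕜 (N x) z) + RCLike.re (inner 𝕜 (N x) (M x - z)) := by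
      rw [inner_sub_right, map_sub]; ring
    have h₃ : RCLike.re (inner 𝕜 (M x) z) + RCLike.re (inner 𝕜 (N x) z) = 0 := by
      rw [← map_add, ← inner_add_left, hz, map_zero]
    have h₄ : RCLike.re (inner 𝕜 (N x) (M x - z)) ≤ ‖M x‖ * ‖M x - z‖ :=
      (re_inner_le_norm _ _).trans (mul_le_mul_of_nonneg_right (hNM x) (norm_nonneg _))
    have h₅ : ‖N x‖ ^ 2 ≤ ‖M x‖ ^ 2 := pow_le_pow_left₀ (norm_nonneg _) (hNM x) 2
    linarith
  have hlim : Tendsto (fun x ↦ 2 * ‖M x‖ ^ 2 - 2 * RCLike.re (inner 𝕜 (M x) z) +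
      2 * (‖M x‖ * ‖M x - z‖)) l (𝓝 0) := by
    have hc : Continuous (fun y : X ↦ 2 * ‖y‖ ^ 2 - 2 * RCLike.re (inner 𝕜 y z) +
        2 * (‖y‖ * ‖y - z‖)) := by
      have := RCLike.continuous_re (K := 𝕜)
      fun_prop
    have h := (hc.tendsto z).comp hM
    simpa [inner_self_eq_norm_sq, Function.comp_def] using h
  have hsq := squeeze_zero (fun x ↦ sq_nonneg ‖M x + N x‖) hbound hlim
  rw [tendsto_zero_iff_norm_tendsto_zero]
  simpa using hsq.sqrt

theorem Submodule.exists_mem_prod_inner_sub_eq_zero {𝕜 E F : Type*} [RCLike 𝕜]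
    [NormedAddCommGroup E] [InnerProductSpace 𝕜 E] [CompleteSpace E]
    [NormedAddCommGroup F] [InnerProductSpace 𝕜 F] [CompleteSpace F]
    (P : Submodule 𝕜 (E × F)) (hP : IsClosed (P : Set (E × F))) (x : E × F) :
    ∃ p ∈ P, ∀ q ∈ P, inner 𝕜 q.1 (x.1 - p.1) + inner 𝕜 q.2 (x.2 - p.2) = 0 := by
  let e := WithLp.prodContinuousLinearEquiv 2 𝕜 E F
  let Q : Submodule 𝕜 (WithLp 2 (E × F)) := P.comap e.toLinearEquiv.toLinearMap
  have hQ : IsClosed (Q : Set (WithLp 2 (E × F))) := hP.preimage e.continuous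
  have : CompleteSpace Q := hQ.completeSpace_coe
  obtain ⟨y, hy, w, hw, hyw⟩ := Q.exists_add_mem_mem_orthogonal (toLp 2 x)
  refine ⟨ofLp y, hy, fun q hq ↦ ?_⟩
  have h := (Q.mem_orthogonal w).1 hw (toLp 2 q) hq
  have hw' : w = toLp 2 x - y := by rw [hyw]; abel
  rw [hw', prod_inner_apply] at h
  exact h

namespace LinearPMap

variable {𝕜 H K : Type*} [RCLike 𝕜]
  [NormedAddCommGroup H] [InnerProductSpace 𝕜 H] [CompleteSpace H]
  [NormedAddCommGroup K] [InnerProductSpace 𝕜 K]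

theorem mem_graph_adjoint_iff {T : H →ₗ.[𝕜] K} (hT : Dense (T.domain : Set H)) {x : K × H} :
    x ∈ T.adjoint.graph ↔ ∀ h : T.domain, inner 𝕜 (T h) x.1 = inner 𝕜 (h : H) x.2 := by
  rw [adjoint_graph_eq_graph_adjoint hT, Submodule.mem_adjoint_iff]
  simp only [sub_eq_zero]
  constructor
  · intro h y
    exact h y (T y) (T.mem_graph y)
  · rintro h a b hab
    obtain ⟨y, rfl, rfl⟩ := (mem_graph_iff T).1 hab
    exact h y

theorem IsClosable.dense_adjoint_domain_s10 [CompleteSpace K] {T : H →ₗ.[𝕜] K}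
    (hT : Dense (T.domain : Set H)) (hc : T.IsClosable) :
    Dense (T.adjoint.domain : Set K) := by
  rw [Submodule.dense_iff_topologicalClosure_eq_top, Submodule.topologicalClosure_eq_top_iff,
    Submodule.eq_bot_iff]
  intro v hv
  obtain ⟨⟨p₁, p₂⟩, hp, hpq⟩ := T.graph.topologicalClosure.exists_mem_prod_inner_sub_eq_zero
    T.graph.isClosed_topologicalClosure (0, v)
  have hmem : (v - p₂, p₁) ∈ T.adjoint.graph := by
    rw [mem_graph_adjoint_iff hT]
    intro h
    have := hpq _ (T.graph.le_topologicalClosure (T.mem_graph h))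
    simp only [zero_sub, inner_neg_right] at this
    linear_combination this
  have hv' : inner 𝕜 (v - p₂) v = 0 := hv _ (mem_domain_of_mem_graph hmem)
  have h₁ := hpq _ hp
  simp only [zero_sub, inner_neg_right] at h₁
  have h₂ : inner 𝕜 (v - p₂) (v - p₂) + inner 𝕜 p₁ p₁ = 0 := by
    have h₃ := congrArg (starRingEnd 𝕜) h₁
    simp only [_root_.map_add, _root_.map_neg, inner_conj_symm, _root_.map_zero] at h₃
    rw [inner_sub_right, hv']
    linear_combination -h₃
  have h₄ : ‖v - p₂‖ ^ 2 + ‖p₁‖ ^ 2 = 0 := by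
    have := congrArg RCLike.re h₂
    simpa only [_root_.map_add, inner_self_eq_norm_sq, _root_.map_zero] using this
  have hv₂ : v = p₂ := by
    rw [← sub_eq_zero, ← norm_eq_zero]
    nlinarith [sq_nonneg ‖v - p₂‖, sq_nonneg ‖p₁‖]
  have hp₁ : p₁ = 0 := by
    rw [← norm_eq_zero]
    nlinarith [sq_nonneg ‖v - p₂‖, sq_nonneg ‖p₁‖]
  obtain ⟨f, hf⟩ := hc
  rw [hf] at hp
  rw [hv₂]
  exact f.graph_fst_eq_zero_snd hp hp₁

theorem sumRestrict_apply {R E F : Type*} [Ring R] [AddCommGroup E] [Module R E]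
    [AddCommGroup F] [Module R F] (B S : E →ₗ.[R] F) (h : B.domain ≤ S.domain) (x : B.domain) :
    B.sumRestrict S h x = B x + S (Submodule.inclusion h x) := rfl

theorem adjoint_sumRestrict_isFormalAdjoint {B S : H →ₗ.[𝕜] K}
    (hB : Dense (B.domain : Set H)) (hS : Dense (S.domain : Set H))
    (h₁ : B.domain ≤ S.domain) (h₂ : B.adjoint.domain ≤ S.adjoint.domain) :
    (B.adjoint.sumRestrict S.adjoint h₂).IsFormalAdjoint (B.sumRestrict S h₁) := by
  intro k h
  have e₁ := B.adjoint_isFormalAdjoint hB k h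
  have e₂ := S.adjoint_isFormalAdjoint hS (Submodule.inclusion h₂ k) (Submodule.inclusion h₁ h)
  change inner 𝕜 (B.adjoint k + S.adjoint (Submodule.inclusion h₂ k)) (h : H) =
    inner 𝕜 (k : K) (B h + S (Submodule.inclusion h₁ h))
  rw [inner_add_left, inner_add_right]
  exact congrArg₂ (· + ·) e₁ e₂

section Skew

variable (B : H →ₗ.[𝕜] K)

/-- The operator matrix with diagonal entries zero and off-diagonal entries `-S` and `S*`,
restricted to `U × V`. -/
noncomputable def skew (S : H →ₗ.[𝕜] K) {U : Submodule 𝕜 K} {V : Submodule 𝕜 H}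
    (hU : U ≤ S.adjoint.domain) (hV : V ≤ S.domain) (x : U × V) : WithLp 2 (K × H) :=
  toLp 2 (-S (Submodule.inclusion hV x.2), S.adjoint (Submodule.inclusion hU x.1))

/-- The inclusion of `U × V` into the `L²` product. -/
def prodIncl (U : Submodule 𝕜 K) (V : Submodule 𝕜 H) (x : U × V) : WithLp 2 (K × H) :=
  toLp 2 ((x.1 : K), (x.2 : H))

variable {S : H →ₗ.[𝕜] K} {U : Submodule 𝕜 K} {V : Submodule 𝕜 H}
  (hU : U ≤ S.adjoint.domain) (hV : V ≤ S.domain)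

theorem skew_le_rfl (x : S.adjoint.domain × S.domain) :
    skew S le_rfl le_rfl x = toLp 2 (-S x.2, S.adjoint x.1) := rfl

theorem inner_skew (hS : Dense (S.domain : Set H)) (x : U × V)
    (y : S.adjoint.domain × S.domain) :
    inner 𝕜 (skew S hU hV x) (prodIncl S.adjoint.domain S.domain y) =
      -inner 𝕜 (prodIncl U V x) (skew S le_rfl le_rfl y) := by
  have e₁ := (S.adjoint_isFormalAdjoint hS).symm (Submodule.inclusion hV x.2) y.1
  have e₂ := S.adjoint_isFormalAdjoint hS (Submodule.inclusion hU x.1) y.2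
  simp only [Submodule.coe_inclusion] at e₁ e₂
  rw [skew_le_rfl]
  simp only [skew, prodIncl, prod_inner_apply, inner_neg_left, inner_neg_right, e₁, e₂]
  ring

theorem re_inner_skew_self (hS : Dense (S.domain : Set H)) (x : U × V) :
    RCLike.re (inner 𝕜 (skew S hU hV x) (prodIncl U V x)) = 0 := by
  have h := congrArg RCLike.re
    (inner_skew hU hV hS x (Submodule.inclusion hU x.1, Submodule.inclusion hV x.2))
  rw [_root_.map_neg, inner_re_symm (prodIncl U V x)] at h
  change RCLike.re (inner 𝕜 (skew S hU hV x) (prodIncl U V x)) =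
    -RCLike.re (inner 𝕜 (skew S hU hV x) (prodIncl U V x)) at h
  linarith

theorem norm_sq_prodIncl_add_skew (hS : Dense (S.domain : Set H)) (x : U × V) :
    ‖prodIncl U V x + skew S hU hV x‖ ^ 2 = ‖prodIncl U V x‖ ^ 2 + ‖skew S hU hV x‖ ^ 2 := by
  rw [norm_add_sq (𝕜 := 𝕜), inner_re_symm, re_inner_skew_self hU hV hS]
  ring

theorem denseRange_prodIncl_add_skew [CompleteSpace K] (hB : Dense (B.domain : Set H)) :
    DenseRange fun x : B.adjoint.domain × B.domain ↦
      prodIncl B.adjoint.domain B.domain x + skew B le_rfl le_rfl x := by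
  let M : (B.adjoint.domain × B.domain) →ₗ[𝕜] WithLp 2 (K × H) :=
    { toFun := fun x ↦ prodIncl B.adjoint.domain B.domain x + skew B le_rfl le_rfl x
      map_add' := fun x y ↦ by
        apply ofLp_injective
        ext <;> simp [prodIncl, skew, LinearPMap.map_add] <;> abel
      map_smul' := fun c x ↦ by
        apply ofLp_injective
        ext <;> simp [prodIncl, skew, LinearPMap.map_smul] }
  have hM : Dense (LinearMap.range M : Set (WithLp 2 (K × H))) := by
    rw [Submodule.dense_iff_topologicalClosure_eq_top, Submodule.topologicalClosure_eq_top_iff,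
      Submodule.eq_bot_iff]
    intro z hz
    have hzM (k : B.adjoint.domain) (h : B.domain) : inner 𝕜 (M (k, h)) z = 0 :=
      hz _ (LinearMap.mem_range_self M (k, h))
    simp only [M, LinearMap.coe_mk, AddHom.coe_mk, prodIncl, skew_le_rfl, prod_inner_apply,
      ← toLp_add, Prod.mk_add_mk] at hzM
    have hmem : ofLp z ∈ B.adjoint.graph := by
      rw [mem_graph_adjoint_iff hB]
      intro h
      have := hzM 0 h
      simp only [ZeroMemClass.coe_zero, LinearPMap.map_zero, add_zero, zero_add,
        inner_neg_left] at this
      linear_combination -this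
    obtain ⟨k, hk₁, hk₂⟩ := (mem_graph_iff _).1 hmem
    have h := hzM k 0
    simp only [ZeroMemClass.coe_zero, LinearPMap.map_zero, neg_zero, add_zero, zero_add, hk₁,
      hk₂] at h
    rw [← inner_self_eq_zero (𝕜 := 𝕜), prod_inner_apply]
    exact h
  exact hM

end Skew

theorem eq_zero_of_inner_prodIncl_add_skew_eq_zero [CompleteSpace K] {B S : H →ₗ.[𝕜] K}
    (h₁ : B.domain ≤ S.domain) (h₂ : B.adjoint.domain ≤ S.adjoint.domain)
    (hB : Dense (B.domain : Set H)) (hS : Dense (S.domain : Set H))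
    (hS' : Dense (S.adjoint.domain : Set K))
    (hSB : ∀ h : B.domain, ‖S (Submodule.inclusion h₁ h)‖ ^ 2 ≤ ‖B h‖ ^ 2 + ‖(h : H)‖ ^ 2)
    (hSB' : ∀ k : B.adjoint.domain,
      ‖S.adjoint (Submodule.inclusion h₂ k)‖ ^ 2 ≤ ‖B.adjoint k‖ ^ 2 + ‖(k : K)‖ ^ 2)
    {z : WithLp 2 (K × H)}
    (hz : ∀ x, inner 𝕜 (prodIncl B.adjoint.domain B.domain x +
      skew B le_rfl le_rfl x + skew S h₂ h₁ x) z = 0) : z = 0 := by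
  set ι := prodIncl B.adjoint.domain B.domain
  set b := skew B le_rfl le_rfl
  set s := skew S h₂ h₁
  have hle (x) : ‖s x‖ ≤ ‖ι x + b x‖ := by
    refine le_of_sq_le_sq ?_ (norm_nonneg _)
    rw [norm_sq_prodIncl_add_skew le_rfl le_rfl hB, skew_le_rfl]
    simp only [prodIncl, skew, prod_norm_sq_eq_of_L2, toLp_fst, toLp_snd, norm_neg, s]
    linarith [hSB x.2, hSB' x.1]
  let l := comap (fun x ↦ ι x + b x) (𝓝 z)
  have : l.NeBot := comap_neBot_iff_frequently.2 <| by
    simpa [Set.mem_range] using mem_closure_iff_frequently.1 (denseRange_prodIncl_add_skew B hB z)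
  have hM : Tendsto (fun x ↦ ι x + b x) l (𝓝 z) := tendsto_comap
  have hMN := tendsto_add_of_norm_le_of_inner_eq_zero hle hz hM
  have hι : Tendsto ι l (𝓝 0) := by
    refine squeeze_zero_norm (fun x ↦ ?_) (tendsto_zero_iff_norm_tendsto_zero.1 hMN)
    have h := re_inner_le_norm (𝕜 := 𝕜) (ι x + b x + s x) (ι x)
    rw [inner_add_left, inner_add_left, _root_.map_add, _root_.map_add, re_inner_skew_self _ _ hS,
      re_inner_skew_self _ _ hB, add_zero, add_zero, inner_self_eq_norm_mul_norm] at h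
    rcases (norm_nonneg (ι x)).eq_or_lt with h0 | h0
    · rw [← h0]; exact norm_nonneg _
    · exact le_of_mul_le_mul_right h h0
  have hN : Tendsto s l (𝓝 (-z)) := by
    simpa using hMN.sub hM
  have horth (y) : inner 𝕜 z (prodIncl S.adjoint.domain S.domain y) = 0 := by
    have t₁ := hN.inner (𝕜 := 𝕜)
      (tendsto_const_nhds (x := prodIncl S.adjoint.domain S.domain y))
    have t₂ := (hι.inner (𝕜 := 𝕜)
      (tendsto_const_nhds (x := skew S le_rfl le_rfl y))).neg
    simp only [s, inner_skew _ _ hS] at t₁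
    have := tendsto_nhds_unique t₁ t₂
    rwa [inner_neg_left, inner_zero_left, neg_inj] at this
  have hz₁ : z.fst = 0 := hS'.eq_zero_of_inner_left 𝕜 fun a ha ↦ by
    simpa [prodIncl, prod_inner_apply] using horth (⟨a, ha⟩, 0)
  have hz₂ : z.snd = 0 := hS.eq_zero_of_inner_left 𝕜 fun a ha ↦ by
    simpa [prodIncl, prod_inner_apply] using horth (0, ⟨a, ha⟩)
  rw [← norm_eq_zero, ← sq_eq_zero_iff, prod_norm_sq_eq_of_L2, hz₁, hz₂]
  simp

end LinearPMap

open LinearPMap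

theorem sum_closable_stmt10
    (B S : H →ₗ.[𝕜] K)
    (ha₁ : B.domain ≤ S.domain) (ha₂ : B.adjoint.domain ≤ S.adjoint.domain)
    (hb₁ : Dense (B.domain : Set H)) (hb₂ : B.IsClosable)
    (hb₃ : Dense (S.domain : Set H))
    (hc : (B.adjoint.sumRestrict S.adjoint ha₂).IsClosed)
    (hd : ∀ h : B.domain,
      ‖S (Submodule.inclusion ha₁ h)‖ ^ 2 ≤ ‖B h‖ ^ 2 + ‖(h : H)‖ ^ 2)
    (he : ∀ k : B.adjoint.domain,
      ‖S.adjoint (Submodule.inclusion ha₂ k)‖ ^ 2 ≤ ‖B.adjoint k‖ ^ 2 + ‖(k : K)‖ ^ 2) :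
    Dense ((B.sumRestrict S ha₁).domain : Set H) ∧ (B.sumRestrict S ha₁).IsClosable ∧
      (B.sumRestrict S ha₁).adjoint = B.adjoint.sumRestrict S.adjoint ha₂ := by
  have hB' := hb₂.dense_adjoint_domain_s10 hb₁
  have hform := adjoint_sumRestrict_isFormalAdjoint hb₁ hb₃ ha₁ ha₂
  have hdense : Dense ((B.sumRestrict S ha₁).domain : Set H) := hb₁
  have hdense' : Dense ((B.adjoint.sumRestrict S.adjoint ha₂).domain : Set K) := hB'
  refine ⟨hdense, (adjoint_isClosed hdense').isClosable.leIsClosable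
    (hform.le_adjoint hdense'), ?_⟩
  have hle := hform.symm.le_adjoint hdense
  refine le_antisymm (le_of_le_graph fun x hx ↦ ?_) hle
  obtain ⟨p, hp, hpq⟩ := Submodule.exists_mem_prod_inner_sub_eq_zero _ hc x
  have hxp := (mem_graph_adjoint_iff hdense).1 (Submodule.sub_mem _ hx (le_graph_of_le hle hp))
  have hzero : toLp 2 (x - p) = 0 := by
    refine eq_zero_of_inner_prodIncl_add_skew_eq_zero (𝕜 := 𝕜) ha₁ ha₂ hb₁ hb₃ (hB'.mono ha₂)
      hd he fun y ↦ ?_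
    have e₁ := hpq _ (mem_graph (B.adjoint.sumRestrict S.adjoint ha₂) y.1)
    have e₂ := hxp y.2
    rw [sumRestrict_apply] at e₁ e₂
    simp only [inner_add_left, Prod.fst_sub, Prod.snd_sub] at e₁ e₂
    rw [skew_le_rfl]
    simp only [prodIncl, skew, prod_inner_apply, inner_add_left, inner_neg_left, Prod.fst_sub,
      Prod.snd_sub]
    linear_combination e₁ - e₂
  have hx' : x = p := by
    rw [← sub_eq_zero]
    exact congrArg ofLp hzero
  rwa [hx']
end

section
/- Let S and T be linear operators acting in a Hilbert space H such that: (a) S is essentially selfadjoint and dom S ⊆ dom T; (b) ‖Th‖² ≤ ‖Sh‖² + ‖h‖² for all h ∈ dom S; (c) ⟨Th, k⟩ = ⟨h, Tk⟩ for all h, k ∈ dom S; (d) S + T (with domain dom S) is closed. Then S + T is selfadjoint. -/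
/- STATEMENT 13: Corollary 17 of the paper. -/

variable {𝕜 H : Type*} [RCLike 𝕜]
  [NormedAddCommGroup H] [InnerProductSpace 𝕜 H] [CompleteSpace H]

local notation "⟪" x ", " y "⟫" => @inner 𝕜 _ _ x y

section
variable {V K : Type*} [AddCommGroup V] [Module 𝕜 V]
  [NormedAddCommGroup K] [InnerProductSpace 𝕜 K]

theorem LinearMap.denseRange_iff_forall_inner_eq_zero [CompleteSpace K] (L : V →ₗ[𝕜] K) :
    DenseRange L ↔ ∀ v : K, (∀ u, inner 𝕜 v (L u) = 0) → v = 0 := by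
  have h : DenseRange L ↔ Dense (L.range : Set K) := by
    rw [DenseRange, LinearMap.coe_range]
  rw [h, Submodule.dense_iff_topologicalClosure_eq_top, Submodule.topologicalClosure_eq_top_iff,
    Submodule.eq_bot_iff]
  simp [Submodule.mem_orthogonal']

/-- A perturbation of relative bound `t < 1` preserves density of the range. -/
theorem LinearMap.denseRange_add_of_norm_le [CompleteSpace K] {L B : V →ₗ[𝕜] K} {t : ℝ}
    (ht : t < 1) (hL : DenseRange L) (hB : ∀ u, ‖B u‖ ≤ t * ‖L u‖) :
    DenseRange (L + B) := by
  rw [LinearMap.denseRange_iff_forall_inner_eq_zero]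
  intro v hv
  have key : ∀ w : K, ‖inner 𝕜 v w‖ ≤ ‖v‖ * (t * ‖w‖) := by
    intro w
    refine hL.induction_on (p := fun w => ‖inner 𝕜 v w‖ ≤ ‖v‖ * (t * ‖w‖)) w
      (isClosed_le (by fun_prop) (by fun_prop)) fun u => ?_
    have h := hv u
    rw [LinearMap.add_apply, inner_add_right, add_eq_zero_iff_eq_neg] at h
    rw [h, norm_neg]
    exact (norm_inner_le_norm v (B u)).trans (by gcongr; exact hB u)
  have h := key v
  rw [inner_self_eq_norm_sq_to_K] at h
  have h' : ‖v‖ ^ 2 ≤ ‖v‖ * (t * ‖v‖) := by simpa using h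
  by_contra hne
  have : 0 < ‖v‖ ^ 2 := by positivity
  nlinarith

/-- Wüst's theorem for skew-symmetric operators `A`, `B` with common dense domain `V`,
embedded in `K` by `ι`. -/
theorem LinearMap.denseRange_add_of_skew [CompleteSpace K] {ι A B : V →ₗ[𝕜] K}
    (hι : DenseRange ι) (hA : ∀ u, RCLike.re (inner 𝕜 (A u) (ι u)) = 0)
    (hB : ∀ u w, inner 𝕜 (B u) (ι w) = -inner 𝕜 (ι u) (B w))
    (hAB : ∀ u, ‖B u‖ ≤ ‖(ι + A) u‖) (hd : DenseRange (ι + A)) :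
    DenseRange (ι + A + B) := by
  rw [LinearMap.denseRange_iff_forall_inner_eq_zero]
  intro v hv
  have hBre : ∀ u, RCLike.re (inner 𝕜 (B u) (ι u)) = 0 := by
    intro u
    have h := congrArg RCLike.re (hB u u)
    rw [map_neg, inner_re_symm (ι u)] at h
    linarith
  -- approximate solutions of the equation with perturbation `(1 - s) • B`
  have approx : ∀ s : ℝ, 0 < s → s ≤ 1 → ∃ u, ‖v - ((ι + A + B) u - (s : 𝕜) • B u)‖ ≤ s ∧
      ‖ι u‖ ≤ ‖v‖ + s ∧ s * ‖B u‖ ≤ ‖v‖ + s := by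
    intro s hs hs1
    have hdense : DenseRange (ι + A + ((1 - s : ℝ) : 𝕜) • B) := by
      refine LinearMap.denseRange_add_of_norm_le (t := 1 - s) (by linarith) hd ?_
      intro u
      rw [LinearMap.smul_apply, norm_smul, RCLike.norm_ofReal, abs_of_nonneg (by linarith)]
      exact mul_le_mul_of_nonneg_left (hAB u) (by linarith)
    obtain ⟨u, hu⟩ := hdense.exists_dist_lt v hs
    have hL : (ι + A + ((1 - s : ℝ) : 𝕜) • B) u = (ι + A + B) u - (s : 𝕜) • B u := by
      simp only [LinearMap.add_apply, LinearMap.smul_apply]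
      push_cast
      module
    have hbd : ‖(ι + A + ((1 - s : ℝ) : 𝕜) • B) u‖ ≤ ‖v‖ + s := by
      have := norm_le_norm_add_norm_sub' ((ι + A + ((1 - s : ℝ) : 𝕜) • B) u) v
      rw [dist_eq_norm, norm_sub_rev] at hu
      linarith
    refine ⟨u, ?_, ?_, ?_⟩
    · rw [← hL, ← dist_eq_norm]
      exact hu.le
    · have h1 : RCLike.re (inner 𝕜 ((ι + A + ((1 - s : ℝ) : 𝕜) • B) u) (ι u)) = ‖ι u‖ ^ 2 := by
        simp only [LinearMap.add_apply, LinearMap.smul_apply, inner_add_left, inner_smul_left,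
          map_add, RCLike.conj_ofReal, RCLike.re_ofReal_mul, hA, hBre,
          inner_self_eq_norm_sq]
        ring
      have h2 := (h1.symm.trans_le (re_inner_le_norm _ _))
      by_contra! hlt
      have : 0 ≤ ‖v‖ := norm_nonneg v
      nlinarith
    · have h3 : ‖(ι + A) u‖ ≤ ‖(ι + A + ((1 - s : ℝ) : 𝕜) • B) u‖ + (1 - s) * ‖B u‖ := by
        have h4 : (ι + A) u = (ι + A + ((1 - s : ℝ) : 𝕜) • B) u - ((1 - s : ℝ) : 𝕜) • B u := by
          simp only [LinearMap.add_apply, LinearMap.smul_apply]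
          abel
        calc ‖(ι + A) u‖ = ‖(ι + A + ((1 - s : ℝ) : 𝕜) • B) u - ((1 - s : ℝ) : 𝕜) • B u‖ := by
              rw [← h4]
          _ ≤ _ := norm_sub_le _ _
          _ = _ := by
            rw [norm_smul, RCLike.norm_ofReal, abs_of_nonneg (by linarith : 0 ≤ 1 - s)]
      have := hAB u
      linarith
  have key : ∀ (w : V) (s : ℝ), 0 < s → s ≤ 1 →
      ‖v‖ ^ 2 ≤ ‖v‖ * s + (‖v - ι w‖ * (‖v‖ + s) + s * ((‖v‖ + s) * ‖B w‖)) := by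
    intro w s hs hs1
    obtain ⟨u, h1, h2, h3⟩ := approx s hs hs1
    have e : inner 𝕜 v v = inner 𝕜 v (v - ((ι + A + B) u - (s : 𝕜) • B u))
        - (inner 𝕜 (v - ι w) ((s : 𝕜) • B u) - s * inner 𝕜 (B w) (ι u)) := by
      have hw : inner 𝕜 (ι w) (B u) = -inner 𝕜 (B w) (ι u) := by rw [hB, neg_neg]
      rw [inner_sub_right, inner_sub_right, hv u, inner_sub_left, inner_smul_right,
        inner_smul_right, hw]
      ring
    have hn : ‖v‖ ^ 2 = ‖inner 𝕜 v v‖ := by simp [inner_self_eq_norm_sq_to_K]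
    rw [hn, e]
    refine (norm_sub_le _ _).trans (add_le_add ?_ ((norm_sub_le _ _).trans (add_le_add ?_ ?_)))
    · exact (norm_inner_le_norm _ _).trans (by gcongr)
    · refine (norm_inner_le_norm _ _).trans ?_
      rw [norm_smul, RCLike.norm_ofReal, abs_of_pos hs]
      gcongr
    · rw [norm_mul, RCLike.norm_ofReal, abs_of_pos hs]
      gcongr
      refine (norm_inner_le_norm _ _).trans ?_
      rw [mul_comm]
      gcongr
  have key' : ∀ w : V, ‖v‖ ^ 2 ≤ ‖v - ι w‖ * ‖v‖ := by
    intro w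
    have hlim : Filter.Tendsto (fun s : ℝ =>
        ‖v‖ * s + (‖v - ι w‖ * (‖v‖ + s) + s * ((‖v‖ + s) * ‖B w‖)))
        (nhdsWithin 0 (Set.Ioi 0)) (nhds (‖v - ι w‖ * ‖v‖)) := by
      refine tendsto_nhdsWithin_of_tendsto_nhds (Continuous.tendsto' (by fun_prop) _ _ (by simp))
    refine ge_of_tendsto hlim ?_
    filter_upwards [Ioc_mem_nhdsGT (zero_lt_one' ℝ)] with s hs using key w s hs.1 hs.2
  have key'' : ∀ x : K, ‖v‖ ^ 2 ≤ ‖v - x‖ * ‖v‖ := fun x =>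
    hι.induction_on (p := fun x => ‖v‖ ^ 2 ≤ ‖v - x‖ * ‖v‖) x
      (isClosed_le (by fun_prop) (by fun_prop)) key'
  have := key'' v
  rw [sub_self, norm_zero, zero_mul] at this
  simpa using (le_antisymm this (by positivity))

end

section

variable {V : Type*} [AddCommGroup V] [Module 𝕜 V]
  {E : Type*} [NormedAddCommGroup E] [InnerProductSpace 𝕜 E]

/-- The map `(x, y) ↦ (f x, f y)` into the Hilbert space `E × E`. -/
noncomputable def LinearMap.diagL2 (f : V →ₗ[𝕜] E) : V × V →ₗ[𝕜] WithLp 2 (E × E) :=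
  (WithLp.linearEquiv 2 𝕜 (E × E)).symm.toLinearMap ∘ₗ f.prodMap f

/-- The map `(x, y) ↦ (-f y, f x)` into the Hilbert space `E × E`. -/
noncomputable def LinearMap.rotL2 (f : V →ₗ[𝕜] E) : V × V →ₗ[𝕜] WithLp 2 (E × E) :=
  (WithLp.linearEquiv 2 𝕜 (E × E)).symm.toLinearMap ∘ₗ
    (-(f ∘ₗ LinearMap.snd 𝕜 V V)).prod (f ∘ₗ LinearMap.fst 𝕜 V V)

theorem LinearMap.diagL2_apply (f : V →ₗ[𝕜] E) (u : V × V) :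
    f.diagL2 u = WithLp.toLp 2 (f u.1, f u.2) := rfl

theorem LinearMap.rotL2_apply (f : V →ₗ[𝕜] E) (u : V × V) :
    f.rotL2 u = WithLp.toLp 2 (-f u.2, f u.1) := rfl

theorem LinearMap.rotL2_add (f g : V →ₗ[𝕜] E) : (f + g).rotL2 = f.rotL2 + g.rotL2 := by
  refine LinearMap.ext fun u => WithLp.ofLp_injective 2 (Prod.ext ?_ rfl)
  exact neg_add (f u.2) (g u.2)

theorem LinearMap.denseRange_diagL2_add_rotL2_iff (f g : V →ₗ[𝕜] H) :
    DenseRange (f.diagL2 + g.rotL2) ↔ ∀ a b : H, (∀ x, ⟪a, f x⟫ + ⟪b, g x⟫ = 0) →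
      (∀ x, ⟪a, g x⟫ = ⟪b, f x⟫) → a = 0 ∧ b = 0 := by
  rw [LinearMap.denseRange_iff_forall_inner_eq_zero]
  constructor
  · intro h a b h1 h2
    have := h (WithLp.toLp 2 (a, b)) fun u => by
      have e1 := h1 u.1
      have e2 := h2 u.2
      simp only [LinearMap.add_apply, LinearMap.diagL2_apply, LinearMap.rotL2_apply,
        inner_add_right, WithLp.prod_inner_apply, inner_neg_right]
      linear_combination e1 - e2
    simpa using this
  · intro h v hv
    have := h v.fst v.snd (fun x => by
      have e := hv (x, 0)
      simpa [LinearMap.diagL2_apply, LinearMap.rotL2_apply, inner_add_right] using e)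
      (fun x => by
      have e := hv (0, x)
      simp [LinearMap.diagL2_apply, LinearMap.rotL2_apply, inner_add_right] at e
      linear_combination -e)
    exact WithLp.ofLp_injective 2 (Prod.ext this.1 this.2)

theorem LinearPMap.IsEssentiallySelfAdjoint.isFormalAdjoint {S : H →ₗ.[𝕜] H}
    (hS : S.IsEssentiallySelfAdjoint) : S.IsFormalAdjoint S := by
  obtain ⟨-, -, hsa⟩ := hS
  have h := LinearPMap.adjoint_isFormalAdjoint hsa.dense_domain
  rw [LinearPMap.isSelfAdjoint_def.mp hsa] at h
  intro x y
  have hle := S.le_closure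
  rw [hle.2 (x := x) (y := ⟨x, hle.1 x.2⟩) rfl, hle.2 (x := y) (y := ⟨y, hle.1 y.2⟩) rfl]
  exact h ⟨x, hle.1 x.2⟩ ⟨y, hle.1 y.2⟩

theorem LinearPMap.IsEssentiallySelfAdjoint.denseRange {S : H →ₗ.[𝕜] H}
    (hS : S.IsEssentiallySelfAdjoint) :
    DenseRange (S.domain.subtype.diagL2 + S.toFun.rotL2) := by
  obtain ⟨-, hcl, hsa⟩ := hS
  rw [LinearMap.denseRange_diagL2_add_rotL2_iff]
  intro a b h1 h2
  have extend : ∀ c d : H, (∀ x : S.domain, ⟪c, (x : H)⟫ + ⟪d, S x⟫ = 0) →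
      ∀ p ∈ S.closure.graph, ⟪c, p.1⟫ + ⟪d, p.2⟫ = 0 := by
    intro c d h p hp
    rw [← hcl.graph_closure_eq_closure_graph] at hp
    refine closure_minimal (t := {p : H × H | ⟪c, p.1⟫ + ⟪d, p.2⟫ = 0}) ?_
      (isClosed_eq (by fun_prop) (by fun_prop)) hp
    intro q hq
    obtain ⟨x, rfl⟩ := (LinearPMap.mem_graph_iff' S).mp hq
    exact h x
  have hab : ∀ x : S.closure.domain, ⟪b, (x : H)⟫ = ⟪a, S.closure x⟫ := by
    intro x
    have := extend b (-a) (fun x => by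
      have e : ⟪a, S x⟫ = ⟪b, (x : H)⟫ := h2 x
      rw [inner_neg_left, e, add_neg_cancel]) _ (S.closure.mem_graph x)
    rw [inner_neg_left] at this
    linear_combination this
  have hmem : (a, b) ∈ S.closure.graph := by
    rw [← LinearPMap.isSelfAdjoint_def.mp hsa, LinearPMap.mem_graph_iff]
    have ha := LinearPMap.mem_adjoint_domain_of_exists a ⟨b, hab⟩
    exact ⟨⟨a, ha⟩, rfl, LinearPMap.adjoint_apply_eq hsa.dense_domain ⟨a, ha⟩ hab⟩
  have h0 : ⟪a, a⟫ + ⟪b, b⟫ = 0 := extend a b h1 _ hmem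
  rw [inner_self_eq_norm_sq_to_K, inner_self_eq_norm_sq_to_K] at h0
  have h0' : ‖a‖ ^ 2 + ‖b‖ ^ 2 = 0 := by exact_mod_cast h0
  constructor <;> rw [← norm_eq_zero] <;> nlinarith [norm_nonneg a, norm_nonneg b]

theorem LinearPMap.IsFormalAdjoint.isSelfAdjoint_of_denseRange {A : H →ₗ.[𝕜] H}
    (hA : A.IsFormalAdjoint A) (hdense : Dense (A.domain : Set H)) (hcl : A.IsClosed)
    (hr : DenseRange (A.domain.subtype.diagL2 + A.toFun.rotL2)) : IsSelfAdjoint A := by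
  rw [LinearMap.denseRange_diagL2_add_rotL2_iff] at hr
  rw [LinearPMap.isSelfAdjoint_def]
  refine le_antisymm (LinearPMap.le_of_le_graph ?_)
    (LinearPMap.IsFormalAdjoint.le_adjoint hdense hA)
  rintro ⟨y, z⟩ hyz
  obtain ⟨y, rfl, rfl⟩ := (LinearPMap.mem_graph_iff _).mp hyz
  let G : Submodule 𝕜 (WithLp 2 (H × H)) :=
    A.graph.comap (WithLp.linearEquiv 2 𝕜 (H × H)).toLinearMap
  have hG : _root_.IsClosed (G : Set (WithLp 2 (H × H))) :=
    _root_.IsClosed.preimage (WithLp.prod_continuous_ofLp 2 H H) hcl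
  have : CompleteSpace G := hG.completeSpace_coe
  obtain ⟨q, hq, r, hr', hqr⟩ :=
    G.exists_add_mem_mem_orthogonal (WithLp.toLp 2 ((y : H), A.adjoint y))
  obtain ⟨x, hx1, hx2⟩ := (LinearPMap.mem_graph_iff _).mp (show q.ofLp ∈ A.graph from hq)
  have hr0 := hr r.fst r.snd (fun w => by
    have := (Submodule.mem_orthogonal' _ _).mp hr' (WithLp.toLp 2 ((w : H), A w)) (A.mem_graph w)
    simpa using this) (fun w => by
    have e1 := LinearPMap.adjoint_isFormalAdjoint hdense y w
    have e2 := hA x w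
    have f1 : r.fst = y - x := by
      rw [hx1, eq_sub_iff_add_eq, add_comm]
      exact (congrArg WithLp.fst hqr).symm
    have f2 : r.snd = A.adjoint y - A x := by
      rw [hx2, eq_sub_iff_add_eq, add_comm]
      exact (congrArg WithLp.snd hqr).symm
    change ⟪r.fst, A w⟫ = ⟪r.snd, (w : H)⟫
    rw [f1, f2, inner_sub_left, inner_sub_left, e1, e2])
  have hrz : r = 0 := WithLp.ofLp_injective 2 (Prod.ext hr0.1 hr0.2)
  rw [hrz, add_zero] at hqr
  rw [← hqr] at hq
  exact hq

end

theorem sum_closable_stmt13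
    (S T : H →ₗ.[𝕜] H)
    (ha₁ : S.IsEssentiallySelfAdjoint) (ha₂ : S.domain ≤ T.domain)
    (hb : ∀ h : S.domain,
      ‖T (Submodule.inclusion ha₂ h)‖ ^ 2 ≤ ‖S h‖ ^ 2 + ‖(h : H)‖ ^ 2)
    (hc : ∀ h k : S.domain,
      ⟪T (Submodule.inclusion ha₂ h), (k : H)⟫ =
        ⟪(h : H), T (Submodule.inclusion ha₂ k)⟫)
    (hd : (S.sumRestrict T ha₂).IsClosed) :
    IsSelfAdjoint (S.sumRestrict T ha₂) := by
  have hS := ha₁.isFormalAdjoint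
  set T' : S.domain →ₗ[𝕜] H := T.toFun.comp (Submodule.inclusion ha₂)
  have hsym : (S.sumRestrict T ha₂).IsFormalAdjoint (S.sumRestrict T ha₂) := by
    intro x y
    change ⟪S x + T (Submodule.inclusion ha₂ x), (y : H)⟫ =
      ⟪(x : H), S y + T (Submodule.inclusion ha₂ y)⟫
    rw [inner_add_left, inner_add_right, hS x y, hc x y]
  refine hsym.isSelfAdjoint_of_denseRange ha₁.1 hd ?_
  have hι : DenseRange S.domain.subtype.diagL2 := by
    have h : DenseRange S.domain.subtype := by
      simpa [DenseRange] using ha₁.1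
    exact (WithLp.linearEquiv 2 𝕜 (H × H)).symm.surjective.denseRange.comp (h.prodMap h)
      (WithLp.prod_continuous_toLp 2 H H)
  have hsum : S.domain.subtype.diagL2 + (S.toFun + T').rotL2 =
      S.domain.subtype.diagL2 + S.toFun.rotL2 + T'.rotL2 := by
    rw [LinearMap.rotL2_add, add_assoc]
  change DenseRange (S.domain.subtype.diagL2 + (S.toFun + T').rotL2)
  rw [hsum]
  have hSre : ∀ u, RCLike.re (inner 𝕜 (S.toFun.rotL2 u) (S.domain.subtype.diagL2 u)) = 0 := by
    intro u
    have h : RCLike.re ⟪S u.2, (u.1 : H)⟫ = RCLike.re ⟪S u.1, (u.2 : H)⟫ := by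
      rw [hS u.2 u.1, inner_re_symm]
    simpa [LinearMap.diagL2_apply, LinearMap.rotL2_apply, neg_add_eq_zero] using h
  refine LinearMap.denseRange_add_of_skew hι hSre ?_ ?_ ha₁.denseRange
  · intro u w
    have h1 : ⟪T' u.2, (w.1 : H)⟫ = ⟪(u.2 : H), T' w.1⟫ := hc u.2 w.1
    have h2 : ⟪T' u.1, (w.2 : H)⟫ = ⟪(u.1 : H), T' w.2⟫ := hc u.1 w.2
    simp [LinearMap.diagL2_apply, LinearMap.rotL2_apply, h1, h2]
  · intro u
    refine le_of_pow_le_pow_left₀ two_ne_zero (norm_nonneg _) ?_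
    have h1 : ‖T' u.1‖ ^ 2 ≤ ‖S u.1‖ ^ 2 + ‖(u.1 : H)‖ ^ 2 := hb u.1
    have h2 : ‖T' u.2‖ ^ 2 ≤ ‖S u.2‖ ^ 2 + ‖(u.2 : H)‖ ^ 2 := hb u.2
    have e1 : ‖T'.rotL2 u‖ ^ 2 = ‖T' u.2‖ ^ 2 + ‖T' u.1‖ ^ 2 := by
      simp [LinearMap.rotL2_apply, WithLp.prod_norm_sq_eq_of_L2]
    have e2 : ‖S.toFun.rotL2 u‖ ^ 2 = ‖S u.2‖ ^ 2 + ‖S u.1‖ ^ 2 := by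
      simp [LinearMap.rotL2_apply, WithLp.prod_norm_sq_eq_of_L2]
    have e3 : ‖S.domain.subtype.diagL2 u‖ ^ 2 = ‖(u.1 : H)‖ ^ 2 + ‖(u.2 : H)‖ ^ 2 := by
      simp [LinearMap.diagL2_apply, WithLp.prod_norm_sq_eq_of_L2]
    rw [LinearMap.add_apply, norm_add_sq (𝕜 := 𝕜), inner_re_symm, hSre, e1, e2, e3]
    linarith
end

section
/- Let S and T be linear operators acting in a Hilbert space H such that: (a) S is selfadjoint and dom S ⊆ dom T; (b) there exists 0 ≤ q < 1 such that ‖Th‖² ≤ q‖Sh‖² + ‖h‖² for all h ∈ dom S; (c) ⟨Th, k⟩ = ⟨h, Tk⟩ for all h, k ∈ dom S. Then S + T (with domain dom S) is selfadjoint. -/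
/- STATEMENT 14: Corollary 19 of the paper (generalized Kato–Rellich theorem). -/

variable {𝕜 H : Type*} [RCLike 𝕜]
  [NormedAddCommGroup H] [InnerProductSpace 𝕜 H] [CompleteSpace H]

local notation "⟪" x ", " y "⟫" => @inner 𝕜 _ _ x y

/-- A linear perturbation of a surjective linear map that is relatively bounded with bound less
than one is again surjective. -/
theorem LinearMap.surjective_add_of_norm_le {R X K : Type*} [Ring R] [AddCommGroup X] [Module R X]
    [NormedAddCommGroup K] [Module R K] [CompleteSpace K] {M N : X →ₗ[R] K}
    (hM : Function.Surjective M) {d : ℝ} (hd : d < 1) (hN : ∀ x, ‖N x‖ ≤ d * ‖M x‖) :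
    Function.Surjective (M + N) := by
  intro w₀
  obtain ⟨r, hr⟩ := hM.hasRightInverse
  have hc : ContractingWith d.toNNReal fun w => w₀ - N (r w) := by
    refine ⟨by simpa using hd, LipschitzWith.of_dist_le_mul fun w w' => ?_⟩
    have h := hN (r w' - r w)
    rw [map_sub, map_sub, hr, hr] at h
    rw [dist_eq_norm, dist_eq_norm, sub_sub_sub_cancel_left, norm_sub_rev w w']
    exact h.trans (mul_le_mul_of_nonneg_right (Real.le_coe_toNNReal d) (norm_nonneg _))
  refine ⟨r hc.fixedPoint, ?_⟩
  have hfix : w₀ - N (r hc.fixedPoint) = hc.fixedPoint := hc.fixedPoint_isFixedPt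
  rw [LinearMap.add_apply, hr]
  exact (sub_eq_iff_eq_add.mp hfix).symm

namespace LinearPMap

/-- The block operator `(h, k) ↦ (A h - c k, c h + A k)`, a substitute for `A + c i` that makes
sense over real scalars as well. -/
noncomputable def blockMap {E : Type*} [NormedAddCommGroup E] [InnerProductSpace 𝕜 E]
    (A : E →ₗ.[𝕜] E) (c : ℝ) :
    A.domain × A.domain →ₗ[𝕜] WithLp 2 (E × E) :=
  (WithLp.linearEquiv 2 𝕜 (E × E)).symm.toLinearMap ∘ₗ
    LinearMap.prod
      (A.toFun ∘ₗ LinearMap.fst 𝕜 _ _ - (c : 𝕜) • A.domain.subtype ∘ₗ LinearMap.snd 𝕜 _ _)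
      ((c : 𝕜) • A.domain.subtype ∘ₗ LinearMap.fst 𝕜 _ _ + A.toFun ∘ₗ LinearMap.snd 𝕜 _ _)

theorem blockMap_apply {E : Type*} [NormedAddCommGroup E] [InnerProductSpace 𝕜 E]
    (A : E →ₗ.[𝕜] E) (c : ℝ) (x : A.domain × A.domain) :
    A.blockMap c x =
      WithLp.toLp 2 (A x.1 - (c : 𝕜) • (x.2 : E), (c : 𝕜) • (x.1 : E) + A x.2) :=
  rfl

theorem norm_blockMap_sq {E : Type*} [NormedAddCommGroup E] [InnerProductSpace 𝕜 E]
    {A : E →ₗ.[𝕜] E} (hA : A.IsFormalAdjoint A) (c : ℝ)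
    (x : A.domain × A.domain) :
    ‖A.blockMap c x‖ ^ 2 =
      ‖A x.1‖ ^ 2 + ‖A x.2‖ ^ 2 + c ^ 2 * (‖(x.1 : E)‖ ^ 2 + ‖(x.2 : E)‖ ^ 2) := by
  rw [blockMap_apply, WithLp.prod_norm_sq_eq_of_L2]
  change ‖A x.1 - (c : 𝕜) • (x.2 : E)‖ ^ 2 + ‖(c : 𝕜) • (x.1 : E) + A x.2‖ ^ 2 = _
  rw [@norm_sub_sq 𝕜, @norm_add_sq 𝕜]
  simp only [norm_smul, inner_smul_left, inner_smul_right,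
    RCLike.conj_ofReal, RCLike.re_ofReal_mul, hA x.1 x.2, RCLike.norm_ofReal, mul_pow, sq_abs]
  ring

theorem blockMap_surjective_of_isSelfAdjoint {A : H →ₗ.[𝕜] H} (hA : IsSelfAdjoint A) {c : ℝ}
    (hc : c ≠ 0) : Function.Surjective (A.blockMap c) := by
  have hc' : (c : 𝕜) ≠ 0 := by exact_mod_cast hc
  intro w
  let L : WithLp 2 (H × H) →L[𝕜] H × H :=
    (WithLp.fstL 2 𝕜 H H).prod ((c : 𝕜) • WithLp.sndL 2 𝕜 H H)
  let G : Submodule 𝕜 (WithLp 2 (H × H)) := A.graph.comap L.toLinearMap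
  have hG : _root_.IsClosed (G : Set (WithLp 2 (H × H))) := hA.isClosed.preimage L.continuous
  have : CompleteSpace G := hG.completeSpace_coe
  obtain ⟨p, hp, r, hr, hpr⟩ := G.exists_add_mem_mem_orthogonal 
    ((c : 𝕜)⁻¹ • WithLp.toLp 2 (w.snd, w.fst))
  obtain ⟨h, hh, hAh⟩ : ∃ h : A.domain, (h : H) = p.fst ∧ A h = (c : 𝕜) • p.snd :=
    (A.mem_graph_iff).mp hp
  have hadj : ∀ x : A.domain, ⟪-((c : 𝕜) • r.fst), (x : H)⟫ = ⟪r.snd, A x⟫ := by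
    intro x
    have hx : WithLp.toLp 2 ((x : H), (c : 𝕜)⁻¹ • A x) ∈ G :=
      (A.mem_graph_iff).mpr ⟨x, rfl, (smul_inv_smul₀ hc' (A x)).symm⟩
    have h0 := (G.mem_orthogonal' r).mp hr _ hx
    rw [WithLp.prod_inner_apply] at h0
    simp only [WithLp.ofLp_fst, WithLp.ofLp_snd, inner_smul_right] at h0
    rw [inner_neg_left, inner_smul_left, RCLike.conj_ofReal, eq_neg_of_add_eq_zero_left h0,
      mul_neg, neg_neg, mul_inv_cancel_left₀ hc']
  have hk : r.snd ∈ A.adjoint.domain := mem_adjoint_domain_of_exists _ ⟨_, hadj⟩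
  have hAk : A.adjoint ⟨r.snd, hk⟩ = -((c : 𝕜) • r.fst) :=
    adjoint_apply_eq hA.dense_domain _ hadj
  have hle : A.adjoint ≤ A := (isSelfAdjoint_def.mp hA).le
  have hAk' : A ⟨r.snd, hle.1 hk⟩ = -((c : 𝕜) • r.fst) :=
    (hle.2 (x := ⟨r.snd, hk⟩) rfl).symm.trans hAk
  have hw : WithLp.toLp 2 (w.snd, w.fst) = (c : 𝕜) • (p + r) := by
    rw [← hpr, smul_inv_smul₀ hc']
  have hw₁ : w.fst = (c : 𝕜) • (p.snd + r.snd) := congrArg WithLp.snd hw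
  have hw₂ : w.snd = (c : 𝕜) • (p.fst + r.fst) := congrArg WithLp.fst hw
  refine ⟨(h, -⟨r.snd, hle.1 hk⟩), WithLp.ofLp_injective 2 (Prod.ext ?_ ?_)⟩
  · change A h - (c : 𝕜) • -r.snd = w.fst
    rw [hAh, hw₁, smul_neg, sub_neg_eq_add, smul_add]
  · change (c : 𝕜) • (h : H) + A (-⟨r.snd, hle.1 hk⟩) = w.snd
    rw [hh, A.map_neg, hAk', neg_neg, hw₂, smul_add]

theorem isSelfAdjoint_of_blockMap_surjective {A : H →ₗ.[𝕜] H} (hd : Dense (A.domain : Set H))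
    (hA : A.IsFormalAdjoint A) {c : ℝ}
    (hs : Function.Surjective (A.blockMap c)) : IsSelfAdjoint A := by
  have hle : A ≤ A.adjoint := hA.le_adjoint hd
  refine isSelfAdjoint_def.mpr (eq_of_le_of_domain_eq hle (le_antisymm hle.1 ?_)).symm
  intro y hy
  obtain ⟨⟨h, k⟩, hhk⟩ := hs (WithLp.toLp 2 (A.adjoint ⟨y, hy⟩, (c : 𝕜) • y))
  obtain ⟨⟨b, a⟩, hba⟩ := hs (WithLp.toLp 2 (-(k : H), y - h))
  simp only [blockMap_apply, WithLp.toLp.injEq, Prod.mk.injEq] at hhk hba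
  have hu : ∀ x : A.domain, ⟪y - h, A x⟫ = -((c : 𝕜) * ⟪(k : H), (x : H)⟫) := by
    intro x
    rw [inner_sub_left, ← adjoint_isFormalAdjoint hd ⟨y, hy⟩ x, ← hA h x, ← hhk.1,
      inner_sub_left, inner_smul_left, RCLike.conj_ofReal]
    ring
  have hv : ∀ x : A.domain, ⟪(k : H), A x⟫ = (c : 𝕜) * ⟪y - h, (x : H)⟫ := by
    intro x
    rw [← hA k x, eq_sub_of_add_eq' hhk.2, ← smul_sub, inner_smul_left, RCLike.conj_ofReal]
  have h0 : ⟪y - h, y - h⟫ + ⟪(k : H), (k : H)⟫ = 0 := by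
    have h1 : ⟪y - h, y - h⟫ = (c : 𝕜) * ⟪y - h, (b : H)⟫ - (c : 𝕜) * ⟪(k : H), (a : H)⟫ := by
      nth_rw 2 [← hba.2]
      rw [inner_add_right, inner_smul_right, hu]
      ring
    have h2 : ⟪(k : H), (k : H)⟫ = (c : 𝕜) * ⟪(k : H), (a : H)⟫ - (c : 𝕜) * ⟪y - h, (b : H)⟫ := by
      nth_rw 2 [← neg_neg (k : H)]
      rw [← hba.1, inner_neg_right, inner_sub_right, inner_smul_right, hv]
      ring
    rw [h1, h2]
    ring
  have hyh : y - h = 0 := by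
    have h1 := congrArg RCLike.re h0
    rw [_root_.map_add, inner_self_eq_norm_sq, inner_self_eq_norm_sq, _root_.map_zero] at h1
    exact norm_eq_zero.mp (pow_eq_zero_iff two_ne_zero |>.mp
      (by nlinarith [sq_nonneg ‖y - h‖, sq_nonneg ‖(k : H)‖]))
  rw [sub_eq_zero.mp hyh]
  exact h.2

end LinearPMap

theorem sum_closable_stmt14
    (S T : H →ₗ.[𝕜] H)
    (ha₁ : IsSelfAdjoint S) (ha₂ : S.domain ≤ T.domain)
    (hb : ∃ q : ℝ, 0 ≤ q ∧ q < 1 ∧ ∀ h : S.domain,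
      ‖T (Submodule.inclusion ha₂ h)‖ ^ 2 ≤ q * ‖S h‖ ^ 2 + ‖(h : H)‖ ^ 2)
    (hc : ∀ h k : S.domain,
      ⟪T (Submodule.inclusion ha₂ h), (k : H)⟫ =
        ⟪(h : H), T (Submodule.inclusion ha₂ k)⟫) :
    IsSelfAdjoint (S.sumRestrict T ha₂) := by
  obtain ⟨q, hq₀, hq₁, hb⟩ := hb
  have hS : S.IsFormalAdjoint S := by
    have h := LinearPMap.adjoint_isFormalAdjoint ha₁.dense_domain
    rwa [LinearPMap.isSelfAdjoint_def.mp ha₁] at h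
  have hST : (S.sumRestrict T ha₂).IsFormalAdjoint (S.sumRestrict T ha₂) := by
    intro h k
    change ⟪S h + T (Submodule.inclusion ha₂ h), (k : H)⟫ =
      ⟪(h : H), S k + T (Submodule.inclusion ha₂ k)⟫
    rw [inner_add_left, inner_add_right, hS h k, hc h k]
  refine LinearPMap.isSelfAdjoint_of_blockMap_surjective ha₁.dense_domain hST (c := 2) ?_
  let T₀ : S.domain →ₗ[𝕜] H := T.toFun ∘ₗ Submodule.inclusion ha₂
  let N : S.domain × S.domain →ₗ[𝕜] WithLp 2 (H × H) :=
    (WithLp.linearEquiv 2 𝕜 (H × H)).symm.toLinearMap ∘ₗ T₀.prodMap T₀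
  have hN : ∀ x, ‖N x‖ ≤ √(max q (1 / 4)) * ‖S.blockMap 2 x‖ := by
    intro x
    refine le_of_sq_le_sq ?_ (by positivity)
    have hx : ‖N x‖ ^ 2 = ‖T (Submodule.inclusion ha₂ x.1)‖ ^ 2 +
        ‖T (Submodule.inclusion ha₂ x.2)‖ ^ 2 := WithLp.prod_norm_sq_eq_of_L2 _
    rw [mul_pow, Real.sq_sqrt (by positivity), hx, LinearPMap.norm_blockMap_sq hS]
    have h₁ := hb x.1
    have h₂ := hb x.2
    have hq := mul_le_mul_of_nonneg_right (le_max_left q (1 / 4))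
      (add_nonneg (sq_nonneg ‖S x.1‖) (sq_nonneg ‖S x.2‖))
    have hr := mul_le_mul_of_nonneg_right (le_max_right q (1 / 4))
      (add_nonneg (sq_nonneg ‖(x.1 : H)‖) (sq_nonneg ‖(x.2 : H)‖))
    linarith
  have hd : √(max q (1 / 4)) < 1 := by
    rw [Real.sqrt_lt' one_pos, one_pow]
    exact max_lt hq₁ (by norm_num)
  have hsum : S.blockMap 2 + N = (S.sumRestrict T ha₂).blockMap 2 := by
    refine LinearMap.ext fun x => WithLp.ofLp_injective 2 (Prod.ext ?_ ?_)
    · change (S x.1 - ((2 : ℝ) : 𝕜) • (x.2 : H)) + T₀ x.1 =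
        (S x.1 + T₀ x.1) - ((2 : ℝ) : 𝕜) • (x.2 : H)
      abel
    · change (((2 : ℝ) : 𝕜) • (x.1 : H) + S x.2) + T₀ x.2 =
        ((2 : ℝ) : 𝕜) • (x.1 : H) + (S x.2 + T₀ x.2)
      abel
  have := LinearMap.surjective_add_of_norm_le
    (LinearPMap.blockMap_surjective_of_isSelfAdjoint ha₁ two_ne_zero) hd hN
  rwa [hsum] at this
end
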